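/- arXiv:1510.03082 — 9 statements merged into one kernel-verified Lean document; each statement's English description precedes it below -/
import Mathlib

section
/- Let n ≥ 1 and let A be a real n×n matrix. The linear operator 𝔄_A : X ↦ A X Aᵀ on the space of real n×n matrices preserves the subspace Symm(n) of symmetric matrices and the subspace Asymm(n) of antisymmetric matrices, and the determinants of its restrictions satisfy det(𝔄_A restricted to Symm(n)) = (det A)^{n+1} and det(𝔄_A restricted to Asymm(n)) = (det A)^{n−1}. -/
open scoped Matrix
/-- The subspace `Symm(n)` of symmetric `n × n` real matrices. -/
def symmSubmodule (n : ℕ) : Submodule ℝ (Matrix (Fin n) (Fin n) ℝ) where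
  carrier := {X | Xᵀ = X}
  add_mem' := by
    intro a b ha hb
    simp only [Set.mem_setOf_eq] at *
    rw [Matrix.transpose_add, ha, hb]
  zero_mem' := by simp
  smul_mem' := by
    intro c X hX
    simp only [Set.mem_setOf_eq] at *
    rw [Matrix.transpose_smul, hX]

/-- The subspace `Asymm(n)` of antisymmetric `n × n` real matrices. -/
def asymmSubmodule (n : ℕ) : Submodule ℝ (Matrix (Fin n) (Fin n) ℝ) where
  carrier := {X | Xᵀ = -X}
  add_mem' := by
    intro a b ha hb
    simp only [Set.mem_setOf_eq] at *
    rw [Matrix.transpose_add, ha, hb, neg_add]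
  zero_mem' := by simp
  smul_mem' := by
    intro c X hX
    simp only [Set.mem_setOf_eq] at *
    rw [Matrix.transpose_smul, hX, smul_neg]

/-- The linear operator `𝔄_A : X ↦ A * X * Aᵀ` on `n × n` real matrices. -/
def matrixCongrMap {n : ℕ} (A : Matrix (Fin n) (Fin n) ℝ) :
    Matrix (Fin n) (Fin n) ℝ →ₗ[ℝ] Matrix (Fin n) (Fin n) ℝ where
  toFun X := A * X * Aᵀ
  map_add' X Y := by simp [Matrix.mul_add, Matrix.add_mul]
  map_smul' c X := by simp [Matrix.mul_smul, Matrix.smul_mul]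

namespace Matrix

variable {ι K : Type*} [Fintype ι] [DecidableEq ι] [Field K]

theorem diagonal_mul_transvection_mul_diagonal_inv {d : ι → K} (hd : ∀ k, d k ≠ 0)
    (i j : ι) (c : K) :
    diagonal d * transvection i j c * diagonal d⁻¹ = transvection i j (d i * c * (d j)⁻¹) := by
  ext k l
  rw [mul_diagonal, diagonal_mul]
  simp only [transvection, add_apply, one_apply, single_apply, Pi.inv_apply]
  split_ifs <;> simp_all [mul_add, add_mul]

/-- A multiplicative map on matrices over a field of characteristic zero is trivial on
transvections, because each transvection is conjugate to its own square. -/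
theorem monoidHom_transvection [CharZero K] (f : Matrix ι ι K →* K) {i j : ι} (hij : i ≠ j)
    (c : K) : f (transvection i j c) = 1 := by
  set d : ι → K := Function.update 1 i 2 with hd
  have hd0 : ∀ k, d k ≠ 0 := fun k => by
    by_cases hk : k = i <;> simp [hd, hk]
  have hconj := congrArg f (diagonal_mul_transvection_mul_diagonal_inv hd0 i j c)
  have hdinv : f (diagonal d) * f (diagonal d⁻¹) = 1 := by
    rw [← map_mul, diagonal_mul_diagonal, ← map_one f, ← diagonal_one]
    congr 2
    ext k
    exact mul_inv_cancel₀ (hd0 k)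
  have hunit : f (transvection i j c) * f (transvection i j (-c)) = 1 := by
    rw [← map_mul, transvection_mul_transvection_same i j hij, add_neg_cancel,
      transvection_zero, map_one]
  have hsq : d i * c * (d j)⁻¹ = c + c := by
    simp [hd, hij.symm, two_mul]
  rw [hsq, ← transvection_mul_transvection_same i j hij, map_mul, map_mul, map_mul,
    mul_right_comm, hdinv, one_mul] at hconj
  exact (mul_eq_left₀ (left_ne_zero_of_mul_eq_one hunit)).mp hconj.symm

theorem monoidHom_eq_of_diagonal [CharZero K] {f g : Matrix ι ι K →* K}
    (h : ∀ d, f (diagonal d) = g (diagonal d)) : f = g := by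
  ext A
  induction A using diagonal_transvection_induction with
  | hdiag d _ => exact h d
  | htransvec t =>
    exact (monoidHom_transvection f t.hij t.c).trans (monoidHom_transvection g t.hij t.c).symm
  | hmul A B hA hB => rw [map_mul, map_mul, hA, hB]

end Matrix

theorem LinearMap.det_eq_prod_of_equiv {R M κ : Type*} [CommRing R] [AddCommGroup M] [Module R M]
    [Fintype κ] [DecidableEq κ] (e : M ≃ₗ[R] (κ → R)) (f : M →ₗ[R] M) (v : κ → R)
    (h : ∀ x k, e (f x) k = v k * e x k) : LinearMap.det f = ∏ k, v k := by
  rw [← LinearMap.det_conj f e, ← Matrix.det_diagonal, ← LinearMap.det_toLin']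
  congr 1
  refine LinearMap.ext fun x => funext fun k => ?_
  simp [h, Matrix.mulVec_diagonal]

section Products

variable {M : Type*} [CommMonoid M] {n : ℕ}

theorem Fin.prod_pairs_lt (d : Fin n → M) :
    ∏ p : {p : Fin n × Fin n // p.1 < p.2}, d p.1.1 * d p.1.2 = (∏ i, d i) ^ (n - 1) := by
  calc
    _ = ∏ i, ∏ j, if i < j then d i * d j else 1 := by
      rw [← Fintype.prod_prod_type', ← Finset.prod_filter]
      exact (Finset.prod_subtype _ (by simp) fun p : Fin n × Fin n => d p.1 * d p.2).symm
    _ = (∏ i, ∏ j, if i < j then d i else 1) * ∏ i, ∏ j, if j < i then d i else 1 := by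
      rw [Finset.prod_comm (f := fun i j => if j < i then d i else 1)]
      simp_rw [← Finset.prod_mul_distrib]
      refine Finset.prod_congr rfl fun i _ => Finset.prod_congr rfl fun j _ => ?_
      split_ifs <;> simp
    _ = ∏ i, ∏ j, if j ≠ i then d i else 1 := by
      simp_rw [← Finset.prod_mul_distrib]
      refine Finset.prod_congr rfl fun i _ => Finset.prod_congr rfl fun j _ => ?_
      rcases lt_trichotomy i j with h | rfl | h <;> simp [*, not_lt_of_gt, ne_of_gt, ne_of_lt]
    _ = _ := by
      simp_rw [← Finset.prod_filter, Finset.prod_const, Finset.filter_ne']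
      simp [Finset.prod_pow]

theorem Fin.prod_pairs_le (d : Fin n → M) :
    ∏ p : {p : Fin n × Fin n // p.1 ≤ p.2}, d p.1.1 * d p.1.2 = (∏ i, d i) ^ (n + 1) := by
  calc
    _ = ∏ i, ∏ j, if i ≤ j then d i * d j else 1 := by
      rw [← Fintype.prod_prod_type', ← Finset.prod_filter]
      exact (Finset.prod_subtype _ (by simp) fun p : Fin n × Fin n => d p.1 * d p.2).symm
    _ = (∏ i, ∏ j, if i ≤ j then d i else 1) * ∏ i, ∏ j, if j ≤ i then d i else 1 := by
      rw [Finset.prod_comm (f := fun i j => if j ≤ i then d i else 1)]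
      simp_rw [← Finset.prod_mul_distrib]
      refine Finset.prod_congr rfl fun i _ => Finset.prod_congr rfl fun j _ => ?_
      split_ifs <;> simp
    _ = ∏ i, ∏ j, d i * if j = i then d i else 1 := by
      simp_rw [← Finset.prod_mul_distrib]
      refine Finset.prod_congr rfl fun i _ => Finset.prod_congr rfl fun j _ => ?_
      rcases lt_trichotomy i j with h | rfl | h <;> simp [*, le_of_lt, ne_of_gt, ne_of_lt]
    _ = _ := by
      simp_rw [Finset.prod_mul_distrib]
      simp [Finset.prod_pow, pow_succ]

end Products

theorem matrixCongrMap_apply {n : ℕ} (A X : Matrix (Fin n) (Fin n) ℝ) :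
    matrixCongrMap A X = A * X * Aᵀ := rfl

theorem matrixCongrMap_diagonal_apply {n : ℕ} (d : Fin n → ℝ) (X : Matrix (Fin n) (Fin n) ℝ)
    (i j : Fin n) : matrixCongrMap (Matrix.diagonal d) X i j = d i * d j * X i j := by
  simp [matrixCongrMap_apply, mul_right_comm]

theorem matrixCongrMap_mem_symmSubmodule {n : ℕ} (A : Matrix (Fin n) (Fin n) ℝ) :
    ∀ X ∈ symmSubmodule n, matrixCongrMap A X ∈ symmSubmodule n := fun X (hX : Xᵀ = X) => by
  change (A * X * Aᵀ)ᵀ = A * X * Aᵀ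
  simp [Matrix.transpose_mul, hX, Matrix.mul_assoc]

theorem matrixCongrMap_mem_asymmSubmodule {n : ℕ} (A : Matrix (Fin n) (Fin n) ℝ) :
    ∀ X ∈ asymmSubmodule n, matrixCongrMap A X ∈ asymmSubmodule n := fun X (hX : Xᵀ = -X) => by
  change (A * X * Aᵀ)ᵀ = -(A * X * Aᵀ)
  simp [Matrix.transpose_mul, hX, Matrix.mul_assoc]

/-- The determinant of `X ↦ A * X * Aᵀ` on an invariant subspace, as a function of `A`. -/
noncomputable def detCongrRestrict {n : ℕ} (S : Submodule ℝ (Matrix (Fin n) (Fin n) ℝ))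
    (hS : ∀ A, ∀ X ∈ S, matrixCongrMap A X ∈ S) : Matrix (Fin n) (Fin n) ℝ →* ℝ where
  toFun A := LinearMap.det ((matrixCongrMap A).restrict (hS A))
  map_one' := by
    rw [← LinearMap.det_id (M := S)]
    congr 1
    ext X : 2
    simp [matrixCongrMap_apply]
  map_mul' A B := by
    rw [← LinearMap.det_comp]
    congr 1
    ext X : 2
    simp [matrixCongrMap_apply, Matrix.mul_assoc]

/-- A symmetric matrix is determined by its entries on and above the diagonal. -/
def symmSubmoduleEquiv (n : ℕ) :
    symmSubmodule n ≃ₗ[ℝ] ({p : Fin n × Fin n // p.1 ≤ p.2} → ℝ) where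
  toFun X p := X.1 p.1.1 p.1.2
  map_add' _ _ := rfl
  map_smul' _ _ := rfl
  invFun v := ⟨Matrix.of fun i j => v ⟨(min i j, max i j), min_le_max⟩, by
    change Matrix.transpose _ = _
    ext i j
    simp [min_comm, max_comm]⟩
  left_inv X := by
    ext i j
    rcases le_total i j with h | h
    · simp [h]
    · simpa [h] using congrFun₂ X.2 i j
  right_inv v := by
    ext ⟨⟨i, j⟩, h⟩
    have h' : i ≤ j := h
    simp [h']

/-- An antisymmetric matrix is determined by its entries above the diagonal. -/
def asymmSubmoduleEquiv (n : ℕ) :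
    asymmSubmodule n ≃ₗ[ℝ] ({p : Fin n × Fin n // p.1 < p.2} → ℝ) where
  toFun X p := X.1 p.1.1 p.1.2
  map_add' _ _ := rfl
  map_smul' _ _ := rfl
  invFun v := ⟨Matrix.of fun i j =>
      if h : i < j then v ⟨(i, j), h⟩ else if h : j < i then -v ⟨(j, i), h⟩ else 0, by
    change Matrix.transpose _ = -_
    ext i j
    rcases lt_trichotomy i j with h | rfl | h <;> simp [*, not_lt_of_gt]⟩
  left_inv X := by
    ext i j
    have hX : X.1 j i = -X.1 i j := congrFun₂ X.2 i j
    rcases lt_trichotomy i j with h | rfl | h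
    · simp [h]
    · simpa using (self_eq_neg.mp hX).symm
    · simp [h, not_lt_of_gt, hX]
  right_inv v := by
    ext ⟨⟨i, j⟩, h⟩
    exact dif_pos h

/-- The operator `X ↦ A X Aᵀ` preserves the symmetric and the antisymmetric matrices, and
the determinants of its restrictions to these subspaces are `(det A)^(n+1)` and
`(det A)^(n-1)` respectively. -/
theorem stmt0 (n : ℕ) (hn : 1 ≤ n) (A : Matrix (Fin n) (Fin n) ℝ) :
    ∃ (hS : ∀ X ∈ symmSubmodule n, matrixCongrMap A X ∈ symmSubmodule n)
      (hA : ∀ X ∈ asymmSubmodule n, matrixCongrMap A X ∈ asymmSubmodule n),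
      LinearMap.det ((matrixCongrMap A).restrict hS) = A.det ^ (n + 1) ∧
      LinearMap.det ((matrixCongrMap A).restrict hA) = A.det ^ (n - 1) := by
  refine ⟨matrixCongrMap_mem_symmSubmodule A, matrixCongrMap_mem_asymmSubmodule A, ?_, ?_⟩
  · have h : detCongrRestrict _ matrixCongrMap_mem_symmSubmodule =
        (powMonoidHom (n + 1)).comp Matrix.detMonoidHom :=
      Matrix.monoidHom_eq_of_diagonal fun d =>
        (LinearMap.det_eq_prod_of_equiv (symmSubmoduleEquiv n) _ (fun p => d p.1.1 * d p.1.2)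
          fun X p => matrixCongrMap_diagonal_apply d X.1 p.1.1 p.1.2).trans <| by
            simp [Fin.prod_pairs_le, Finset.prod_pow]
    exact DFunLike.congr_fun h A
  · have h : detCongrRestrict _ matrixCongrMap_mem_asymmSubmodule =
        (powMonoidHom (n - 1)).comp Matrix.detMonoidHom :=
      Matrix.monoidHom_eq_of_diagonal fun d =>
        (LinearMap.det_eq_prod_of_equiv (asymmSubmoduleEquiv n) _ (fun p => d p.1.1 * d p.1.2)
          fun X p => matrixCongrMap_diagonal_apply d X.1 p.1.1 p.1.2).trans <| by
            simp [Fin.prod_pairs_lt, Finset.prod_pow]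
    exact DFunLike.congr_fun h A
end

section
/- Let p, q ∈ ℕ and let g = [[α,β],[γ,δ]] be a real orthogonal (p+q)×(p+q) block matrix, i.e., g·gᵀ = 1, with α of size p×p and δ of size q×q. Let T be a real p×q matrix such that α + Tγ is invertible, and set T^[g] := (α + Tγ)⁻¹(β + Tδ). Then det(1 + T^[g]·(T^[g])ᵀ) · (det(α + Tγ))² = det(1 + T·Tᵀ). -/
open scoped Matrix

/-- If `[[α,β],[γ,δ]]` is orthogonal, then the Gram matrix of the rows of `[1, T] * g` equals
that of the rows of `[1, T]`. -/
theorem gram_mul_fromBlocks_of_orthogonal {R m n : Type*} [CommRing R]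
    [Fintype m] [Fintype n] [DecidableEq m] [DecidableEq n]
    {α : Matrix m m R} {β : Matrix m n R} {γ : Matrix n m R} {δ : Matrix n n R}
    (horth : Matrix.fromBlocks α β γ δ * (Matrix.fromBlocks α β γ δ)ᵀ = 1)
    (T : Matrix m n R) :
    (α + T * γ) * (α + T * γ)ᵀ + (β + T * δ) * (β + T * δ)ᵀ = 1 + T * Tᵀ := by
  rw [Matrix.fromBlocks_transpose, Matrix.fromBlocks_multiply, ← Matrix.fromBlocks_one,
    Matrix.fromBlocks_inj] at horth
  obtain ⟨h11, h12, h21, h22⟩ := horth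
  calc (α + T * γ) * (α + T * γ)ᵀ + (β + T * δ) * (β + T * δ)ᵀ
      = (α * αᵀ + β * βᵀ) + (α * γᵀ + β * δᵀ) * Tᵀ + T * (γ * αᵀ + δ * βᵀ)
          + T * (γ * γᵀ + δ * δᵀ) * Tᵀ := by
        simp only [Matrix.transpose_add, Matrix.transpose_mul, Matrix.add_mul, Matrix.mul_add,
          Matrix.mul_assoc]
        abel
    _ = 1 + T * Tᵀ := by simp [h11, h12, h21, h22]

/-- For an orthogonal block matrix `g = [[α,β],[γ,δ]]` and `T` with `α + Tγ` invertible,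
setting `T^[g] = (α+Tγ)⁻¹(β+Tδ)`, one has
`det(1 + T^[g] (T^[g])ᵀ) · (det(α+Tγ))² = det(1 + T Tᵀ)`. -/
theorem stmt4 (p q : ℕ)
    (α : Matrix (Fin p) (Fin p) ℝ) (β : Matrix (Fin p) (Fin q) ℝ)
    (γ : Matrix (Fin q) (Fin p) ℝ) (δ : Matrix (Fin q) (Fin q) ℝ)
    (horth : Matrix.fromBlocks α β γ δ * (Matrix.fromBlocks α β γ δ)ᵀ = 1)
    (T : Matrix (Fin p) (Fin q) ℝ) (h : IsUnit (α + T * γ)) :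
    (1 + ((α + T * γ)⁻¹ * (β + T * δ)) * ((α + T * γ)⁻¹ * (β + T * δ))ᵀ).det *
        ((α + T * γ).det) ^ 2 =
      (1 + T * Tᵀ).det := by
  have hdet : IsUnit (α + T * γ).det := (Matrix.isUnit_iff_isUnit_det _).mp h
  rw [← gram_mul_fromBlocks_of_orthogonal horth T]
  set A := α + T * γ
  set B := β + T * δ
  have hX : A * (A⁻¹ * B) = B := Matrix.mul_nonsing_inv_cancel_left A B hdet
  set X := A⁻¹ * B
  have hfactor : A * Aᵀ + B * Bᵀ = A * (1 + X * Xᵀ) * Aᵀ := by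
    rw [← hX]
    simp only [Matrix.transpose_mul, Matrix.add_mul, Matrix.mul_add, Matrix.mul_assoc,
      Matrix.mul_one]
  rw [hfactor, Matrix.det_mul, Matrix.det_mul, Matrix.det_transpose]
  ring
end

section
/- Let p, q ≥ 1 and let g = [[α,β],[γ,δ]] be a real orthogonal (p+q)×(p+q) block matrix (g·gᵀ = 1). Let λ be Lebesgue measure on the space Mat_{p×q}(ℝ) ≅ ℝ^{pq} of real p×q matrices, and let μ be the measure with density T ↦ det(1 + T·Tᵀ)^{−(p+q)/2} with respect to λ. Let U = {T ∈ Mat_{p×q}(ℝ) : α + Tγ is invertible}. Then the complement of U is λ-null, and the pushforward under the map T ↦ (α + Tγ)⁻¹(β + Tδ) of the restriction of μ to U equals μ. In other words, μ is invariant under the fractional-linear action of the orthogonal group O(p+q,ℝ). -/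
open MeasureTheory
open scoped Matrix

/-- Lebesgue measure on the space of `p × q` real matrices `≅ ℝ^{pq}`. -/
noncomputable instance matrixRealMeasureSpace (p q : ℕ) :
    MeasureSpace (Matrix (Fin p) (Fin q) ℝ) :=
  inferInstanceAs (MeasureSpace (Fin p → Fin q → ℝ))

open scoped Kronecker in
theorem det_mul_left_right {m n : Type*} [Fintype m] [Fintype n] [DecidableEq m] [DecidableEq n]
    (M : Matrix m m ℝ) (N : Matrix n n ℝ) (L : Matrix m n ℝ →ₗ[ℝ] Matrix m n ℝ)
    (hL : ∀ H, L H = M * H * N) :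
    LinearMap.det L = M.det ^ Fintype.card n * N.det ^ Fintype.card m := by
  let e : Matrix m n ℝ ≃ₗ[ℝ] (n × m → ℝ) :=
    { Equiv.ofBijective Matrix.vec Matrix.vec_bijective with
      map_add' := Matrix.vec_add
      map_smul' := Matrix.vec_smul }
  have h : (e : Matrix m n ℝ →ₗ[ℝ] (n × m → ℝ)) ∘ₗ L ∘ₗ (e.symm : (n × m → ℝ) →ₗ[ℝ] _) =
      Matrix.toLin' (Nᵀ ⊗ₖ M) := by
    refine LinearMap.ext fun v => ?_
    obtain ⟨X, rfl⟩ := e.surjective v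
    have h1 : e X = X.vec := rfl
    have h2 : e (M * X * N) = (M * X * N).vec := rfl
    simp only [LinearMap.comp_apply, LinearEquiv.coe_coe, LinearEquiv.symm_apply_apply, hL,
      Matrix.toLin'_apply]
    rw [h1, h2, Matrix.kronecker_mulVec_vec, Matrix.transpose_transpose]
  rw [← LinearMap.det_conj L e, h, LinearMap.det_toLin', Matrix.det_kronecker,
    Matrix.det_transpose, mul_comm]
theorem exists_injective_add_comp {K V W : Type*} [Field K] [AddCommGroup V] [Module K V]
    [FiniteDimensional K V] [AddCommGroup W] [Module K W] (a : V →ₗ[K] V) (c : V →ₗ[K] W)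
    (h : ∀ x, a x = 0 → c x = 0 → x = 0) :
    ∃ T : W →ₗ[K] V, Function.Injective (a + T ∘ₗ c) := by
  obtain ⟨R, hR⟩ := Submodule.exists_isCompl (LinearMap.range a)
  have hdim : Module.finrank K (LinearMap.ker a) = Module.finrank K R := by
    have h1 := Submodule.finrank_add_eq_of_isCompl hR
    have h2 := LinearMap.finrank_range_add_finrank_ker a
    omega
  let e := LinearEquiv.ofFinrankEq _ _ hdim
  obtain ⟨g, hg⟩ := LinearMap.exists_leftInverse_of_injective (c ∘ₗ (LinearMap.ker a).subtype) (by
    rw [LinearMap.ker_eq_bot']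
    rintro ⟨x, hx⟩ hcx
    exact Subtype.ext (h x hx hcx))
  refine ⟨R.subtype ∘ₗ e.toLinearMap ∘ₗ g, ?_⟩
  rw [← LinearMap.ker_eq_bot, LinearMap.ker_eq_bot']
  intro x hx
  have hx' : a x + (e (g (c x)) : V) = 0 := hx
  have hax : a x = 0 := by
    refine Submodule.disjoint_def.1 hR.disjoint _ ⟨x, rfl⟩ ?_
    rw [eq_neg_of_add_eq_zero_left hx']
    exact R.neg_mem (e (g (c x))).2
  have hgx : g (c x) = ⟨x, hax⟩ := LinearMap.congr_fun hg ⟨x, hax⟩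
  rw [hax, zero_add, ZeroMemClass.coe_eq_zero, e.map_eq_zero_iff, hgx] at hx'
  exact congrArg Subtype.val hx'

theorem exists_isUnit_add_mul {m n : Type*} [Fintype m] [Fintype n] [DecidableEq m]
    [DecidableEq n] (α : Matrix m m ℝ) (γ : Matrix n m ℝ) (h : αᵀ * α + γᵀ * γ = 1) :
    ∃ T : Matrix m n ℝ, IsUnit (α + T * γ) := by
  obtain ⟨T, hT⟩ := exists_injective_add_comp (Matrix.toLin' α) (Matrix.toLin' γ) (by
    intro x hα hγ
    rw [Matrix.toLin'_apply] at hα hγ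
    rw [← Matrix.one_mulVec x, ← h, Matrix.add_mulVec, ← Matrix.mulVec_mulVec,
      ← Matrix.mulVec_mulVec, hα, hγ, Matrix.mulVec_zero, Matrix.mulVec_zero, add_zero])
  refine ⟨LinearMap.toMatrix' T, Matrix.mulVec_injective_iff_isUnit.1 ?_⟩
  convert hT using 1
  ext1 x
  rw [Matrix.add_mulVec, ← Matrix.mulVec_mulVec, LinearMap.toMatrix'_mulVec]
  rfl

theorem addHaar_eq_zero_of_lines {E : Type*} [NormedAddCommGroup E] [NormedSpace ℝ E]
    [FiniteDimensional ℝ E] [MeasurableSpace E] [BorelSpace E] (μ : Measure E)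
    [μ.IsAddHaarMeasure] {Z : Set E} (hZ : MeasurableSet Z) (x : E)
    (h : ∀ v : E, {t : ℝ | x + t • v ∈ Z}.Countable) : μ Z = 0 := by
  have hmeas : MeasurableSet {z : ℝ × E | x + z.1 • z.2 ∈ Z} :=
    (show Measurable fun z : ℝ × E => x + z.1 • z.2 from
      (by fun_prop : Continuous fun z : ℝ × E => x + z.1 • z.2).measurable) hZ
  have h0 : (volume.prod μ) {z : ℝ × E | x + z.1 • z.2 ∈ Z} = 0 := by
    rw [Measure.prod_apply_symm hmeas]
    simp only [Set.preimage_ofPred_eq]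
    simp [(h _).measure_zero]
  have h1 := Measure.measure_ae_null_of_prod_null h0
  have h2 : ∀ᵐ t : ℝ, t ≠ 0 := Measure.ae_ne volume 0
  obtain ⟨t, ht, ht0⟩ := (h1.and h2).exists
  have h3 : Prod.mk t ⁻¹' {z : ℝ × E | x + z.1 • z.2 ∈ Z} =
      (fun v => t • v) ⁻¹' ((fun v => x + v) ⁻¹' Z) := rfl
  change μ (Prod.mk t ⁻¹' _) = 0 at ht
  rw [h3, Measure.addHaar_preimage_smul μ ht0, measure_preimage_add] at ht
  simpa [ht0] using ht

theorem countable_setOf_not_isUnit {m : Type*} [Fintype m] [DecidableEq m]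
    (A B : Matrix m m ℝ) (hA : IsUnit A) : {t : ℝ | ¬ IsUnit (A + t • B)}.Countable := by
  let P : Polynomial ℝ := (A.map (Polynomial.C : ℝ →+* Polynomial ℝ) + (Polynomial.X : Polynomial ℝ) •
      B.map (Polynomial.C : ℝ →+* Polynomial ℝ)).det
  have hP (t : ℝ) : P.eval t = (A + t • B).det := by
    rw [← Polynomial.coe_evalRingHom, RingHom.map_det]
    congr 1
    ext i j
    simp [mul_comm (B i j)]
  have hP0 : P ≠ 0 := by
    intro h0
    have := hP 0
    rw [Matrix.isUnit_iff_isUnit_det] at hA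
    rw [h0, Polynomial.eval_zero, zero_smul, add_zero] at this
    exact hA.ne_zero this.symm
  refine (P.roots.toFinset.finite_toSet.subset fun t ht => ?_).countable
  rw [Set.mem_ofPred_eq, Matrix.isUnit_iff_isUnit_det, isUnit_iff_ne_zero, not_not, ← hP] at ht
  simp [hP0, ht]

theorem hasFDerivWithinAt_of_sub_eq {E F : Type*} [NormedAddCommGroup E] [NormedSpace ℝ E]
    [NormedAddCommGroup F] [NormedSpace ℝ F] {f : E → F} {s : Set E} {x : E} {L : E → E →L[ℝ] F}
    (hL : ContinuousWithinAt L s x) (h : ∀ y ∈ s, f y - f x = L y (y - x)) :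
    HasFDerivWithinAt f (L x) s x := by
  rw [hasFDerivWithinAt_iff_isLittleO, Asymptotics.isLittleO_iff]
  intro c hc
  filter_upwards [Metric.tendsto_nhds.1 hL c hc, self_mem_nhdsWithin] with y hy hys
  rw [h y hys, ← sub_apply]
  exact (ContinuousLinearMap.le_opNorm _ _).trans (by rw [dist_eq_norm] at hy; gcongr)

/-- The fractional-linear map `T ↦ (α + Tγ)⁻¹(β + Tδ)`. -/
noncomputable def fracLin {m n : Type*} [Fintype m] [Fintype n] [DecidableEq m]
    (α : Matrix m m ℝ) (β : Matrix m n ℝ) (γ : Matrix n m ℝ) (δ : Matrix n n ℝ)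
    (T : Matrix m n ℝ) : Matrix m n ℝ :=
  (α + T * γ)⁻¹ * (β + T * δ)

theorem fracLin_sub_fracLin {m n : Type*} [Fintype m] [Fintype n] [DecidableEq m]
    {α : Matrix m m ℝ} {β : Matrix m n ℝ} {γ : Matrix n m ℝ} {δ : Matrix n n ℝ}
    {T S : Matrix m n ℝ} (hT : IsUnit (α + T * γ)) (hS : IsUnit (α + S * γ)) :
    fracLin α β γ δ S - fracLin α β γ δ T =
      (α + S * γ)⁻¹ * (S - T) * (δ - γ * fracLin α β γ δ T) := by
  have hA := (Matrix.isUnit_iff_isUnit_det _).1 hT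
  have hA' := (Matrix.isUnit_iff_isUnit_det _).1 hS
  have hB : (α + T * γ) * fracLin α β γ δ T = β + T * δ :=
    Matrix.mul_nonsing_inv_cancel_left _ _ hA
  have key : (S - T) * (δ - γ * fracLin α β γ δ T) =
      (β + S * δ) - (α + S * γ) * fracLin α β γ δ T := by
    calc _ = (S * δ - S * γ * fracLin α β γ δ T) - (T * δ - T * γ * fracLin α β γ δ T) := by
          simp only [Matrix.sub_mul, Matrix.mul_sub, Matrix.mul_assoc]
          abel
      _ = _ := by
          have : T * δ - T * γ * fracLin α β γ δ T = α * fracLin α β γ δ T - β := by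
            rw [Matrix.add_mul] at hB
            rw [sub_eq_sub_iff_add_eq_add, add_comm, ← hB]
          rw [this, Matrix.add_mul]
          abel
  rw [Matrix.mul_assoc, key, Matrix.mul_sub, Matrix.nonsing_inv_mul_cancel_left _ _ hA', fracLin,
    fracLin]

section Algebra

variable {m n : Type*} [Fintype m] [Fintype n] [DecidableEq m] [DecidableEq n]
  {α : Matrix m m ℝ} {β : Matrix m n ℝ} {γ : Matrix n m ℝ} {δ : Matrix n n ℝ}

theorem fromBlocks_orthogonal_transpose
    (h : Matrix.fromBlocks α β γ δ * (Matrix.fromBlocks α β γ δ)ᵀ = 1) :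
    Matrix.fromBlocks αᵀ γᵀ βᵀ δᵀ * (Matrix.fromBlocks αᵀ γᵀ βᵀ δᵀ)ᵀ = 1 := by
  rw [← Matrix.fromBlocks_transpose, Matrix.transpose_transpose]
  exact mul_eq_one_comm.1 h

theorem fromBlocks_orthogonal_rows
    (h : Matrix.fromBlocks α β γ δ * (Matrix.fromBlocks α β γ δ)ᵀ = 1) :
    α * αᵀ + β * βᵀ = 1 ∧ α * γᵀ + β * δᵀ = 0 ∧ γ * αᵀ + δ * βᵀ = 0 ∧ γ * γᵀ + δ * δᵀ = 1 := by
  rw [Matrix.fromBlocks_transpose, Matrix.fromBlocks_multiply, ← Matrix.fromBlocks_one,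
    Matrix.fromBlocks_inj] at h
  exact h

theorem fracLin_denom (h : Matrix.fromBlocks α β γ δ * (Matrix.fromBlocks α β γ δ)ᵀ = 1)
    {T : Matrix m n ℝ} (hT : IsUnit (α + T * γ)) :
    αᵀ + fracLin α β γ δ T * βᵀ = (α + T * γ)⁻¹ := by
  obtain ⟨h1, -, h3, -⟩ := fromBlocks_orthogonal_rows h
  have key : (α + T * γ) * αᵀ + (β + T * δ) * βᵀ = 1 := by
    calc _ = (α * αᵀ + β * βᵀ) + T * (γ * αᵀ + δ * βᵀ) := by
          simp only [Matrix.add_mul, Matrix.mul_add, Matrix.mul_assoc]; abel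
      _ = 1 := by rw [h1, h3, Matrix.mul_zero, add_zero]
  rw [Matrix.isUnit_iff_isUnit_det] at hT
  rw [fracLin, Matrix.mul_assoc, eq_sub_of_add_eq' key, Matrix.mul_sub, Matrix.mul_one,
    Matrix.nonsing_inv_mul_cancel_left _ _ hT, add_sub_cancel]

theorem fracLin_num (h : Matrix.fromBlocks α β γ δ * (Matrix.fromBlocks α β γ δ)ᵀ = 1)
    {T : Matrix m n ℝ} (hT : IsUnit (α + T * γ)) :
    γᵀ + fracLin α β γ δ T * δᵀ = (α + T * γ)⁻¹ * T := by
  obtain ⟨-, h2, -, h4⟩ := fromBlocks_orthogonal_rows h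
  have key : (α + T * γ) * γᵀ + (β + T * δ) * δᵀ = T := by
    calc _ = (α * γᵀ + β * δᵀ) + T * (γ * γᵀ + δ * δᵀ) := by
          simp only [Matrix.add_mul, Matrix.mul_add, Matrix.mul_assoc]; abel
      _ = T := by rw [h2, h4, Matrix.mul_one, zero_add]
  rw [Matrix.isUnit_iff_isUnit_det] at hT
  rw [fracLin, Matrix.mul_assoc, eq_sub_of_add_eq' key, Matrix.mul_sub,
    Matrix.nonsing_inv_mul_cancel_left _ _ hT, add_sub_cancel]

theorem isUnit_fracLin_denom
    (h : Matrix.fromBlocks α β γ δ * (Matrix.fromBlocks α β γ δ)ᵀ = 1)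
    {T : Matrix m n ℝ} (hT : IsUnit (α + T * γ)) :
    IsUnit (αᵀ + fracLin α β γ δ T * βᵀ) := by
  rw [fracLin_denom h hT]
  exact (Matrix.isUnit_nonsing_inv_iff).2 hT

theorem fracLin_transpose_fracLin
    (h : Matrix.fromBlocks α β γ δ * (Matrix.fromBlocks α β γ δ)ᵀ = 1)
    {T : Matrix m n ℝ} (hT : IsUnit (α + T * γ)) :
    fracLin αᵀ γᵀ βᵀ δᵀ (fracLin α β γ δ T) = T := by
  rw [fracLin, fracLin_denom h hT, fracLin_num h hT]
  rw [Matrix.isUnit_iff_isUnit_det] at hT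
  rw [Matrix.nonsing_inv_nonsing_inv _ hT, Matrix.mul_nonsing_inv_cancel_left _ _ hT]

theorem det_one_add_fracLin
    (h : Matrix.fromBlocks α β γ δ * (Matrix.fromBlocks α β γ δ)ᵀ = 1)
    {T : Matrix m n ℝ} (hT : IsUnit (α + T * γ)) :
    (α + T * γ).det ^ 2 * (1 + fracLin α β γ δ T * (fracLin α β γ δ T)ᵀ).det =
      (1 + T * Tᵀ).det := by
  have hA := (Matrix.isUnit_iff_isUnit_det _).1 hT
  have key : (α + T * γ) * (1 + fracLin α β γ δ T * (fracLin α β γ δ T)ᵀ) * (α + T * γ)ᵀ =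
      1 + T * Tᵀ := by
    obtain ⟨h1, h2, h3, h4⟩ := fromBlocks_orthogonal_rows h
    have hB : (α + T * γ) * fracLin α β γ δ T = β + T * δ :=
      Matrix.mul_nonsing_inv_cancel_left _ _ hA
    have hBt : (fracLin α β γ δ T)ᵀ * (α + T * γ)ᵀ = (β + T * δ)ᵀ := by
      rw [← Matrix.transpose_mul, hB]
    calc _ = (α + T * γ) * (α + T * γ)ᵀ +
          ((α + T * γ) * fracLin α β γ δ T) * ((fracLin α β γ δ T)ᵀ * (α + T * γ)ᵀ) := by
          simp only [Matrix.mul_add, Matrix.add_mul, Matrix.mul_assoc, Matrix.mul_one]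
      _ = (α * αᵀ + β * βᵀ) + T * (γ * αᵀ + δ * βᵀ) + (α * γᵀ + β * δᵀ) * Tᵀ +
          T * (γ * γᵀ + δ * δᵀ) * Tᵀ := by
          rw [hB, hBt]
          simp only [Matrix.transpose_add, Matrix.transpose_mul, Matrix.add_mul, Matrix.mul_add,
            Matrix.mul_assoc]
          abel
      _ = 1 + T * Tᵀ := by
          rw [h1, h2, h3, h4, Matrix.mul_zero, Matrix.zero_mul, add_zero, add_zero, Matrix.mul_one]
  rw [← key, Matrix.det_mul, Matrix.det_mul, Matrix.det_transpose]
  ring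

theorem abs_det_mul_det_sub
    (h : Matrix.fromBlocks α β γ δ * (Matrix.fromBlocks α β γ δ)ᵀ = 1)
    {T : Matrix m n ℝ} (hT : IsUnit (α + T * γ)) :
    |(α + T * γ).det| * |(δ - γ * fracLin α β γ δ T).det| = 1 := by
  have hA := (Matrix.isUnit_iff_isUnit_det _).1 hT
  have hB : (α + T * γ) * fracLin α β γ δ T = β + T * δ :=
    Matrix.mul_nonsing_inv_cancel_left _ _ hA
  have key : Matrix.fromBlocks 1 T 0 1 * Matrix.fromBlocks α β γ δ *
      Matrix.fromBlocks 1 (-fracLin α β γ δ T) 0 1 =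
      Matrix.fromBlocks (α + T * γ) 0 γ (δ - γ * fracLin α β γ δ T) := by
    rw [Matrix.fromBlocks_multiply, Matrix.fromBlocks_multiply]
    simp only [Matrix.one_mul, Matrix.zero_mul, Matrix.mul_one, Matrix.mul_zero, zero_add,
      add_zero, Matrix.mul_neg, hB, neg_add_cancel, sub_eq_neg_add]
  have hdet := congrArg Matrix.det key
  rw [Matrix.det_mul, Matrix.det_mul, Matrix.det_fromBlocks_zero₂₁, Matrix.det_fromBlocks_zero₂₁,
    Matrix.det_fromBlocks_zero₁₂] at hdet
  have horth := congrArg Matrix.det h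
  rw [Matrix.det_mul, Matrix.det_transpose, Matrix.det_one] at horth
  rw [← abs_mul, ← hdet]
  rcases mul_self_eq_one_iff.1 horth with h1 | h1 <;> simp [h1]

end Algebra

section Calculus

attribute [local instance] Matrix.normedAddCommGroup Matrix.normedSpace

instance matrixRealBorelSpace (p q : ℕ) : BorelSpace (Matrix (Fin p) (Fin q) ℝ) :=
  inferInstanceAs (BorelSpace (Fin p → Fin q → ℝ))

instance matrixRealBorelSpace_norm (p q : ℕ) :
    @BorelSpace (Matrix (Fin p) (Fin q) ℝ) PseudoMetricSpace.toUniformSpace.toTopologicalSpace _ :=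
  inferInstanceAs (BorelSpace (Fin p → Fin q → ℝ))

instance matrixRealIsAddHaarMeasure_norm (p q : ℕ) :
    @Measure.IsAddHaarMeasure (Matrix (Fin p) (Fin q) ℝ) _
      PseudoMetricSpace.toUniformSpace.toTopologicalSpace _ volume :=
  Measure.pi.isAddHaarMeasure fun _ : Fin p => (volume : Measure (Fin q → ℝ))

variable {p q : ℕ} {α : Matrix (Fin p) (Fin p) ℝ} {β : Matrix (Fin p) (Fin q) ℝ}
  {γ : Matrix (Fin q) (Fin p) ℝ} {δ : Matrix (Fin q) (Fin q) ℝ}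

theorem isOpen_setOf_isUnit_add_mul (α : Matrix (Fin p) (Fin p) ℝ)
    (γ : Matrix (Fin q) (Fin p) ℝ) :
    IsOpen {T : Matrix (Fin p) (Fin q) ℝ | IsUnit (α + T * γ)} := by
  simp only [Matrix.isUnit_iff_isUnit_det, isUnit_iff_ne_zero]
  exact isOpen_ne_fun (by fun_prop) continuous_const

theorem volume_setOf_not_isUnit_add_mul (h : αᵀ * α + γᵀ * γ = 1) :
    volume {T : Matrix (Fin p) (Fin q) ℝ | IsUnit (α + T * γ)}ᶜ = 0 := by
  obtain ⟨T₀, hT₀⟩ := exists_isUnit_add_mul α γ h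
  refine addHaar_eq_zero_of_lines volume
    (isOpen_setOf_isUnit_add_mul α γ).measurableSet.compl T₀ fun v => ?_
  convert countable_setOf_not_isUnit (α + T₀ * γ) (v * γ) hT₀ using 5 with t
  change IsUnit (α + (T₀ + t • v) * γ) ↔ _
  rw [Matrix.add_mul, Matrix.smul_mul, add_assoc]

theorem measurable_fracLin (α : Matrix (Fin p) (Fin p) ℝ) (β : Matrix (Fin p) (Fin q) ℝ)
    (γ : Matrix (Fin q) (Fin p) ℝ) (δ : Matrix (Fin q) (Fin q) ℝ) :
    Measurable (fracLin α β γ δ) := by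
  have h : fracLin α β γ δ = fun T =>
      (α + T * γ).det⁻¹ • ((α + T * γ).adjugate * (β + T * δ)) := by
    ext1 T
    rw [fracLin, Matrix.inv_def, Ring.inverse_eq_inv', Matrix.smul_mul]
  rw [h]
  have h1 : Measurable fun T : Matrix (Fin p) (Fin q) ℝ => (α + T * γ).det :=
    Continuous.measurable (by fun_prop)
  have h2 : Measurable fun T : Matrix (Fin p) (Fin q) ℝ =>
      (α + T * γ).adjugate * (β + T * δ) :=
    Continuous.measurable (by fun_prop)
  exact h1.inv.smul h2

/-- The linear map sending `M` to the operator `H ↦ M * H * N`. -/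
noncomputable def mulLeftRightCLM (N : Matrix (Fin q) (Fin q) ℝ) :
    Matrix (Fin p) (Fin p) ℝ →ₗ[ℝ] Matrix (Fin p) (Fin q) ℝ →L[ℝ] Matrix (Fin p) (Fin q) ℝ where
  toFun M := LinearMap.toContinuousLinearMap
    { toFun := fun H => M * H * N
      map_add' := fun H K => by rw [Matrix.mul_add, Matrix.add_mul]
      map_smul' := fun c H => by rw [Matrix.mul_smul, Matrix.smul_mul, RingHom.id_apply] }
  map_add' M M' := by
    ext1 H
    exact (congrArg (· * N) (Matrix.add_mul M M' H)).trans (Matrix.add_mul _ _ _)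
  map_smul' c M := by
    ext1 H
    exact (congrArg (· * N) (Matrix.smul_mul c M H)).trans (Matrix.smul_mul _ _ _)

theorem det_mulLeftRightCLM (N : Matrix (Fin q) (Fin q) ℝ) (M : Matrix (Fin p) (Fin p) ℝ) :
    (mulLeftRightCLM N M).det = M.det ^ q * N.det ^ p := by
  have := det_mul_left_right M N (mulLeftRightCLM N M : _ →ₗ[ℝ] _) fun H => rfl
  simpa using this

theorem hasFDerivWithinAt_fracLin {T : Matrix (Fin p) (Fin q) ℝ} (hT : IsUnit (α + T * γ)) :
    HasFDerivWithinAt (fracLin α β γ δ)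
      (mulLeftRightCLM (δ - γ * fracLin α β γ δ T) (α + T * γ)⁻¹)
      {T | IsUnit (α + T * γ)} T := by
  refine hasFDerivWithinAt_of_sub_eq
    (L := fun S => mulLeftRightCLM (δ - γ * fracLin α β γ δ T) (α + S * γ)⁻¹)
    (ContinuousAt.continuousWithinAt ?_) fun S hS => fracLin_sub_fracLin hT hS
  have hinv : ContinuousAt (fun S : Matrix (Fin p) (Fin q) ℝ => (α + S * γ)⁻¹) T := by
    simp only [Matrix.inv_def, Ring.inverse_eq_inv']
    have h1 : Continuous fun S : Matrix (Fin p) (Fin q) ℝ => (α + S * γ).det := by fun_prop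
    have h2 : Continuous fun S : Matrix (Fin p) (Fin q) ℝ => (α + S * γ).adjugate := by fun_prop
    exact (h1.continuousAt.inv₀ ((Matrix.isUnit_iff_isUnit_det _).1 hT).ne_zero).smul
      h2.continuousAt
  exact (LinearMap.continuous_of_finiteDimensional
    (mulLeftRightCLM (p := p) (δ - γ * fracLin α β γ δ T))).continuousAt.comp hinv

theorem abs_det_fderiv_fracLin
    (h : Matrix.fromBlocks α β γ δ * (Matrix.fromBlocks α β γ δ)ᵀ = 1)
    {T : Matrix (Fin p) (Fin q) ℝ} (hT : IsUnit (α + T * γ)) :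
    |(mulLeftRightCLM (δ - γ * fracLin α β γ δ T) (α + T * γ)⁻¹).det| =
      |(α + T * γ).det| ^ (-((p : ℝ) + q)) := by
  have hA := ((Matrix.isUnit_iff_isUnit_det _).1 hT).ne_zero
  have hpos := abs_pos.2 hA
  have hD : |(δ - γ * fracLin α β γ δ T).det| = |(α + T * γ).det|⁻¹ :=
    eq_inv_of_mul_eq_one_right (abs_det_mul_det_sub h hT)
  rw [det_mulLeftRightCLM, abs_mul, abs_pow, abs_pow, hD, Matrix.det_nonsing_inv,
    Ring.inverse_eq_inv', abs_inv, ← pow_add, inv_pow, Real.rpow_neg hpos.le, ← Nat.cast_add,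
    Real.rpow_natCast, add_comm q p]

theorem abs_det_mul_density_fracLin
    (h : Matrix.fromBlocks α β γ δ * (Matrix.fromBlocks α β γ δ)ᵀ = 1)
    {T : Matrix (Fin p) (Fin q) ℝ} (hT : IsUnit (α + T * γ)) :
    |(mulLeftRightCLM (δ - γ * fracLin α β γ δ T) (α + T * γ)⁻¹).det| *
      (1 + fracLin α β γ δ T * (fracLin α β γ δ T)ᵀ).det ^ (-(((p : ℝ) + q) / 2)) =
      (1 + T * Tᵀ).det ^ (-(((p : ℝ) + q) / 2)) := by
  have hpos : 0 ≤ (1 + fracLin α β γ δ T * (fracLin α β γ δ T)ᵀ).det := by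
    refine Matrix.PosSemidef.det_nonneg (Matrix.PosSemidef.one.add ?_)
    simpa using Matrix.posSemidef_self_mul_conjTranspose (fracLin α β γ δ T)
  rw [abs_det_fderiv_fracLin h hT, ← det_one_add_fracLin h hT, ← sq_abs,
    Real.mul_rpow (sq_nonneg _) hpos, ← Real.rpow_natCast, ← Real.rpow_mul (abs_nonneg _)]
  congr 2
  push_cast
  ring

theorem fracLin_image (h : Matrix.fromBlocks α β γ δ * (Matrix.fromBlocks α β γ δ)ᵀ = 1)
    (s : Set (Matrix (Fin p) (Fin q) ℝ)) :
    fracLin α β γ δ '' (fracLin α β γ δ ⁻¹' s ∩ {T | IsUnit (α + T * γ)}) =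
      s ∩ {S | IsUnit (αᵀ + S * βᵀ)} := by
  ext S
  constructor
  · rintro ⟨T, ⟨hTs, hT⟩, rfl⟩
    exact ⟨hTs, isUnit_fracLin_denom h hT⟩
  · rintro ⟨hSs, hS⟩
    have ht := fromBlocks_orthogonal_transpose h
    have h1 := fracLin_transpose_fracLin ht hS
    have h2 := isUnit_fracLin_denom ht hS
    simp only [Matrix.transpose_transpose] at h1 h2
    exact ⟨_, ⟨by rwa [Set.mem_preimage, h1], h2⟩, h1⟩

theorem map_fracLin_restrict
    (h : Matrix.fromBlocks α β γ δ * (Matrix.fromBlocks α β γ δ)ᵀ = 1)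
    (μ : Measure (Matrix (Fin p) (Fin q) ℝ))
    (hμ : μ = volume.withDensity
      fun T => ENNReal.ofReal ((1 + T * Tᵀ).det ^ (-(((p : ℝ) + q) / 2)))) :
    Measure.map (fracLin α β γ δ)
      (μ.restrict {T : Matrix (Fin p) (Fin q) ℝ | IsUnit (α + T * γ)}) = μ := by
  have hU := (isOpen_setOf_isUnit_add_mul α γ).measurableSet
  have hφ := measurable_fracLin α β γ δ
  have hV : volume {S : Matrix (Fin p) (Fin q) ℝ | IsUnit (αᵀ + S * βᵀ)}ᶜ = 0 := by
    obtain ⟨h1, -⟩ := fromBlocks_orthogonal_rows h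
    exact volume_setOf_not_isUnit_add_mul (by simpa using h1)
  ext s hs
  have hmeas := (hφ hs).inter hU
  rw [Measure.map_apply hφ hs, Measure.restrict_apply (hφ hs), hμ, withDensity_apply _ hmeas,
    withDensity_apply _ hs]
  calc _ = ∫⁻ T in fracLin α β γ δ ⁻¹' s ∩ {T | IsUnit (α + T * γ)},
        ENNReal.ofReal
          |(mulLeftRightCLM (δ - γ * fracLin α β γ δ T) (α + T * γ)⁻¹).det| *
        ENNReal.ofReal ((1 + fracLin α β γ δ T * (fracLin α β γ δ T)ᵀ).det ^
          (-(((p : ℝ) + q) / 2))) := by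
        refine setLIntegral_congr_fun hmeas fun T hT => ?_
        rw [← ENNReal.ofReal_mul (abs_nonneg _), abs_det_mul_density_fracLin h hT.2]
    _ = ∫⁻ S in s ∩ {S | IsUnit (αᵀ + S * βᵀ)},
        ENNReal.ofReal ((1 + S * Sᵀ).det ^ (-(((p : ℝ) + q) / 2))) := by
        rw [← fracLin_image h s]
        refine (lintegral_image_eq_lintegral_abs_det_fderiv_mul volume hmeas
          (fun T hT => (hasFDerivWithinAt_fracLin hT.2).mono Set.inter_subset_right) ?_
          fun S => ENNReal.ofReal ((1 + S * Sᵀ).det ^ (-(((p : ℝ) + q) / 2)))).symm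
        intro T hT S hS hTS
        rw [← fracLin_transpose_fracLin h hT.2, hTS, fracLin_transpose_fracLin h hS.2]
    _ = ∫⁻ S in s, ENNReal.ofReal ((1 + S * Sᵀ).det ^ (-(((p : ℝ) + q) / 2))) :=
      setLIntegral_congr (inter_ae_eq_left_of_ae_eq_univ (ae_eq_univ.2 hV))
  rfl

end Calculus

/-- The measure `det(1 + T Tᵀ)^{-(p+q)/2} dT` on `p × q` real matrices is invariant under
the fractional-linear action `T ↦ (α + Tγ)⁻¹(β + Tδ)` of any orthogonal block matrix
`g = [[α,β],[γ,δ]] ∈ O(p+q, ℝ)`; moreover the set where `α + Tγ` is not invertible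
is Lebesgue-null. -/
theorem stmt5 (p q : ℕ) (hp : 1 ≤ p) (hq : 1 ≤ q)
    (α : Matrix (Fin p) (Fin p) ℝ) (β : Matrix (Fin p) (Fin q) ℝ)
    (γ : Matrix (Fin q) (Fin p) ℝ) (δ : Matrix (Fin q) (Fin q) ℝ)
    (horth : Matrix.fromBlocks α β γ δ * (Matrix.fromBlocks α β γ δ)ᵀ = 1)
    (μ : Measure (Matrix (Fin p) (Fin q) ℝ))
    (hμ : μ = volume.withDensity
      fun T => ENNReal.ofReal ((1 + T * Tᵀ).det ^ (-(((p : ℝ) + q) / 2)))) :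
    volume ({T : Matrix (Fin p) (Fin q) ℝ | IsUnit (α + T * γ)}ᶜ) = 0 ∧
    Measure.map (fun T => (α + T * γ)⁻¹ * (β + T * δ))
        (μ.restrict {T : Matrix (Fin p) (Fin q) ℝ | IsUnit (α + T * γ)}) = μ := by
  have hcol : αᵀ * α + γᵀ * γ = 1 := by
    simpa using (fromBlocks_orthogonal_rows (fromBlocks_orthogonal_transpose horth)).1
  exact ⟨volume_setOf_not_isUnit_add_mul hcol, map_fracLin_restrict horth μ hμ⟩
end

section
/- Let n ≥ 1 and let α, β : {1,…,n} → ℤ be weakly decreasing sequences of integers (α₁ ≥ α₂ ≥ … ≥ α_n, and similarly for β). For z = (z₁,…,z_n) with |z_j| = 1 define Δ_α(z) = det( z_j^{α_k + n − k} )_{k,j=1}^{n} (the entry in row k, column j is z_j raised to the integer power α_k + n − k). Then (2π)^{−n} ∫_{[0,2π]^n} Δ_α(e^{iφ₁},…,e^{iφ_n}) · conj(Δ_β(e^{iφ₁},…,e^{iφ_n})) dφ₁⋯dφ_n equals n! if α = β, and equals 0 if α ≠ β. (Equivalently, the Schur functions s_α = Δ_α/Δ₀, where Δ₀ is the Vandermonde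 determinant, form an orthonormal system in the space of symmetric functions on the n-torus with the weight (2π)^{−n}(n!)^{−1}|Δ₀|².) -/
open MeasureTheory

/-- `Δ_α(z) = det (z_j ^ (α_k + n − k))` for a weakly decreasing integer sequence `α`
(indices `k` are zero-based, so the exponent is `α k + (n − 1 − k)`). -/
noncomputable def DeltaDet (n : ℕ) (α : Fin n → ℤ) (z : Fin n → ℂ) : ℂ :=
  (Matrix.of fun k j : Fin n => z j ^ (α k + ((n - 1 - (k : ℕ) : ℕ) : ℤ))).det

open scoped Real

/-- Orthogonality of the characters of the circle, written with the angle coordinate. -/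
theorem integral_exp_zpow_mul_conj_exp_zpow (a b : ℤ) :
    ∫ t in Set.Icc (0 : ℝ) (2 * π),
        Complex.exp ((t : ℂ) * Complex.I) ^ a *
          starRingEnd ℂ (Complex.exp ((t : ℂ) * Complex.I) ^ b) =
      if a = b then ((2 * π : ℝ) : ℂ) else 0 := by
  have h (t : ℝ) : Complex.exp ((t : ℂ) * Complex.I) ^ a *
      starRingEnd ℂ (Complex.exp ((t : ℂ) * Complex.I) ^ b) =
        Complex.exp (((a - b : ℤ) * Complex.I) * t) := by
    rw [map_zpow₀, ← Complex.exp_conj, ← Complex.exp_int_mul, ← Complex.exp_int_mul,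
      ← Complex.exp_add]
    congr 1
    simp only [map_mul, Complex.conj_ofReal, Complex.conj_I]
    push_cast
    ring
  simp_rw [h]
  rw [integral_Icc_eq_integral_Ioc, ← intervalIntegral.integral_of_le Real.two_pi_pos.le]
  split_ifs with hab
  · simp [hab]
  · have hc : ((a - b : ℤ) : ℂ) * Complex.I ≠ 0 :=
      mul_ne_zero (Int.cast_ne_zero.2 (sub_ne_zero.2 hab)) Complex.I_ne_zero
    rw [integral_exp_mul_complex hc]
    have h1 : Complex.exp (((a - b : ℤ) * Complex.I) * ((2 * π : ℝ) : ℂ)) = 1 := by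
      rw [Complex.exp_eq_one_iff]
      exact ⟨a - b, by push_cast; ring⟩
    rw [h1]
    simp

/-- Orthogonality of the monomials on the torus. -/
theorem setIntegral_pi_prod_exp_zpow_mul_conj {ι : Type*} [Fintype ι] (a b : ι → ℤ) :
    ∫ φ in Set.univ.pi fun _ : ι => Set.Icc (0 : ℝ) (2 * π),
        ∏ j, (Complex.exp ((φ j : ℂ) * Complex.I) ^ a j *
          starRingEnd ℂ (Complex.exp ((φ j : ℂ) * Complex.I) ^ b j)) =
      if a = b then ((2 * π : ℝ) : ℂ) ^ Fintype.card ι else 0 := by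
  rw [volume_pi, Measure.restrict_pi_pi,
    integral_fintype_prod_eq_prod (fun j (t : ℝ) => Complex.exp ((t : ℂ) * Complex.I) ^ a j *
          starRingEnd ℂ (Complex.exp ((t : ℂ) * Complex.I) ^ b j))]
  simp_rw [integral_exp_zpow_mul_conj_exp_zpow]
  split_ifs with hab
  · simp [hab]
  · obtain ⟨j, hj⟩ := Function.ne_iff.1 hab
    exact Finset.prod_eq_zero (Finset.mem_univ j) (if_neg hj)

/-- Two strictly decreasing families with a common rearrangement are equal, and so are the
rearranging permutations. -/
theorem StrictAnti.comp_perm_eq_comp_perm_iff {n : ℕ} {a b : Fin n → ℤ} (ha : StrictAnti a)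
    (hb : StrictAnti b) (σ τ : Equiv.Perm (Fin n)) :
    (fun j => a (σ j)) = (fun j => b (τ j)) ↔ a = b ∧ σ = τ := by
  refine ⟨fun h => ?_, by rintro ⟨rfl, rfl⟩; rfl⟩
  have hr : Set.range a = Set.range b := by
    rw [← σ.surjective.range_comp a, ← τ.surjective.range_comp b]
    exact congrArg Set.range h
  have hab : a = b := by
    have := (StrictMono.range_inj ha.dual_right hb.dual_right).1
      (by simpa only [Set.range_comp] using congrArg (OrderDual.toDual '' ·) hr)
    exact funext fun j => OrderDual.toDual.injective (congrFun this j)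
  subst hab
  exact ⟨rfl, Equiv.ext fun j => ha.injective (congrFun h j)⟩

theorem strictAnti_add_sub_val {n : ℕ} {α : Fin n → ℤ} (hα : Antitone α) :
    StrictAnti fun k : Fin n => α k + ((n - 1 - (k : ℕ) : ℕ) : ℤ) := by
  intro i j hij
  have h1 := hα hij.le
  have h2 : (i : ℕ) < j := hij
  have h3 := j.isLt
  dsimp only
  omega

theorem DeltaDet_mul_conj (n : ℕ) (α β : Fin n → ℤ) (z : Fin n → ℂ) :
    DeltaDet n α z * starRingEnd ℂ (DeltaDet n β z) =
      ∑ σ : Equiv.Perm (Fin n), ∑ τ : Equiv.Perm (Fin n),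
        ((Equiv.Perm.sign σ : ℤ) : ℂ) * ((Equiv.Perm.sign τ : ℤ) : ℂ) *
          ∏ j, (z j ^ (α (σ j) + ((n - 1 - (σ j : ℕ) : ℕ) : ℤ)) *
            starRingEnd ℂ (z j ^ (β (τ j) + ((n - 1 - (τ j : ℕ) : ℕ) : ℤ)))) := by
  simp only [DeltaDet, Matrix.det_apply', Matrix.of_apply, map_sum, map_mul, map_prod,
    Finset.sum_mul_sum, Finset.prod_mul_distrib, map_intCast]
  refine Finset.sum_congr rfl fun σ _ => Finset.sum_congr rfl fun τ _ => ?_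
  ring

/-- Orthogonality of the functions `Δ_α` on the torus: `(2π)^{-n} ∫_{[0,2π]^n} Δ_α conj Δ_β`
equals `n!` if `α = β` and `0` otherwise (equivalently, the Schur functions form an
orthonormal system for the weight `(2π)^{-n} (n!)^{-1} |Δ₀|²`). -/
theorem stmt11 (n : ℕ) (hn : 1 ≤ n) (α β : Fin n → ℤ) (hα : Antitone α) (hβ : Antitone β) :
    ((2 * Real.pi) ^ n : ℝ)⁻¹ •
      ∫ φ in Set.univ.pi fun _ : Fin n => Set.Icc (0 : ℝ) (2 * Real.pi),
        DeltaDet n α (fun j => Complex.exp ((φ j : ℂ) * Complex.I)) *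
          starRingEnd ℂ (DeltaDet n β fun j => Complex.exp ((φ j : ℂ) * Complex.I)) =
      if α = β then (n.factorial : ℂ) else 0 := by
  have hcompact : IsCompact (Set.univ.pi fun _ : Fin n => Set.Icc (0 : ℝ) (2 * π)) :=
    isCompact_univ_pi fun _ => isCompact_Icc
  have hint (σ τ : Equiv.Perm (Fin n)) : IntegrableOn (fun φ : Fin n → ℝ =>
      ((Equiv.Perm.sign σ : ℤ) : ℂ) * ((Equiv.Perm.sign τ : ℤ) : ℂ) *
        ∏ j, (Complex.exp ((φ j : ℂ) * Complex.I) ^ (α (σ j) + ((n - 1 - (σ j : ℕ) : ℕ) : ℤ)) *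
          starRingEnd ℂ (Complex.exp ((φ j : ℂ) * Complex.I) ^
            (β (τ j) + ((n - 1 - (τ j : ℕ) : ℕ) : ℤ)))))
      (Set.univ.pi fun _ : Fin n => Set.Icc (0 : ℝ) (2 * π)) := by
    refine Continuous.continuousOn ?_ |>.integrableOn_compact hcompact
    simp_rw [← Complex.exp_int_mul]
    have := Complex.continuous_conj
    fun_prop
  simp_rw [DeltaDet_mul_conj]
  rw [integral_finsetSum _ fun σ _ => integrable_finsetSum _ fun τ _ => hint σ τ]
  simp_rw [integral_finsetSum _ fun τ _ => hint _ τ, integral_const_mul,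
    setIntegral_pi_prod_exp_zpow_mul_conj,
    (strictAnti_add_sub_val hα).comp_perm_eq_comp_perm_iff (strictAnti_add_sub_val hβ)]
  have hiff : ((fun k : Fin n => α k + ((n - 1 - (k : ℕ) : ℕ) : ℤ)) =
      fun k => β k + ((n - 1 - (k : ℕ) : ℕ) : ℤ)) ↔ α = β := by
    simp [funext_iff]
  simp_rw [hiff]
  split_ifs with hab
  · have hsign (σ : Equiv.Perm (Fin n)) :
        ((Equiv.Perm.sign σ : ℤ) : ℂ) * ((Equiv.Perm.sign σ : ℤ) : ℂ) = 1 := by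
      rw [← Int.cast_mul, ← Units.val_mul, Int.units_mul_self]
      simp
    have hpi : ((2 * π : ℝ) : ℂ) ^ n ≠ 0 :=
      pow_ne_zero _ (Complex.ofReal_ne_zero.2 Real.two_pi_pos.ne')
    simp only [hab, true_and, mul_ite, mul_zero, Finset.sum_ite_eq, Finset.mem_univ, if_true,
      hsign, one_mul, Finset.sum_const, Finset.card_univ, Fintype.card_perm, Fintype.card_fin,
      nsmul_eq_mul, Complex.real_smul, Complex.ofReal_inv, Complex.ofReal_pow]
    field_simp
  · simp [hab]
end

section
/- Let μ be the countable product, on ℝ^ℕ = (ℕ → ℝ), of standard Gaussian measures N(0,1). Then for μ-almost every x = (x₀, x₁, x₂, …), the limit superior as k → ∞ of |x_k| / √(2 ln k) equals 1. -/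
open MeasureTheory ProbabilityTheory

theorem gaussianReal_abs_ge_le {t : ℝ} (ht : 0 ≤ t) :
    gaussianReal 0 1 {y : ℝ | t ≤ |y|} ≤ ENNReal.ofReal (2 * Real.exp (-t ^ 2 / 2)) := by
  have h : HasSubgaussianMGF (id : ℝ → ℝ) 1 (gaussianReal 0 1) :=
    ⟨fun s => integrable_exp_mul_gaussianReal s, fun s => by simp [mgf_id_gaussianReal]⟩
  have h₁ := h.measure_ge_le ht
  have h₂ := h.neg.measure_ge_le ht
  have hsub : {y : ℝ | t ≤ |y|} ⊆ {y : ℝ | t ≤ id y} ∪ {y : ℝ | t ≤ (-id) y} := by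
    intro y hy
    exact le_abs.mp (show t ≤ |y| from hy)
  have h₃ := (measureReal_mono (μ := gaussianReal 0 1) hsub).trans (measureReal_union_le _ _)
  rw [← ofReal_measureReal]
  apply ENNReal.ofReal_le_ofReal
  simp only [NNReal.coe_one, mul_one] at h₁ h₂
  linarith

theorem le_gaussianReal_Ici {t : ℝ} (ht : 0 ≤ t) :
    ENNReal.ofReal ((Real.sqrt (2 * Real.pi))⁻¹ * Real.exp (-(t + 1) ^ 2 / 2)) ≤
      gaussianReal 0 1 (Set.Ici t) := by
  calc _ = ∫⁻ _ in Set.Icc t (t + 1),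
        ENNReal.ofReal ((Real.sqrt (2 * Real.pi))⁻¹ * Real.exp (-(t + 1) ^ 2 / 2)) := by simp
    _ ≤ ∫⁻ y in Set.Icc t (t + 1), gaussianPDF 0 1 y := by
        refine setLIntegral_mono (measurable_gaussianPDF 0 1) fun y hy => ?_
        rw [gaussianPDF, gaussianPDFReal]
        apply ENNReal.ofReal_le_ofReal
        simp only [NNReal.coe_one, mul_one, sub_zero]
        gcongr
        · exact ht.trans hy.1
        · exact hy.2
    _ = gaussianReal 0 1 (Set.Icc t (t + 1)) := (gaussianReal_apply 0 one_ne_zero _).symm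
    _ ≤ _ := measure_mono Set.Icc_subset_Ici_self

theorem neg_sq_mul_sqrt_two_mul_log (c : ℝ) (k : ℕ) :
    -(c * Real.sqrt (2 * Real.log k)) ^ 2 / 2 = -c ^ 2 * Real.log k := by
  rw [mul_pow, Real.sq_sqrt (mul_nonneg zero_le_two (Real.log_natCast_nonneg k))]
  ring

theorem tsum_gaussianReal_abs_ge_ne_top {c : ℝ} (hc : 1 < c) :
    ∑' k : ℕ, gaussianReal 0 1 {y : ℝ | c * Real.sqrt (2 * Real.log k) ≤ |y|} ≠ ⊤ := by
  have hs : Summable fun k : ℕ =>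
      2 * Real.exp (-(c * Real.sqrt (2 * Real.log k)) ^ 2 / 2) := by
    refine Summable.mul_left 2 ?_
    refine (Real.summable_nat_rpow (p := -c ^ 2).2 (by nlinarith)).congr_atTop ?_
    filter_upwards [Filter.eventually_gt_atTop 0] with k hk
    rw [neg_sq_mul_sqrt_two_mul_log, Real.rpow_def_of_pos (by exact_mod_cast hk), mul_comm]
  refine ne_top_of_le_ne_top hs.tsum_ofReal_ne_top (ENNReal.tsum_le_tsum fun k => ?_)
  exact gaussianReal_abs_ge_le (by positivity)

theorem tsum_gaussianReal_Ici_eq_top {c : ℝ} (hc₀ : 0 < c) (hc₁ : c < 1) :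
    ∑' k : ℕ, gaussianReal 0 1 (Set.Ici (c * Real.sqrt (2 * Real.log k))) = ⊤ := by
  by_contra htop
  have hC : 0 < 1 - c ^ 2 := by nlinarith
  set C := (Real.sqrt (2 * Real.pi))⁻¹ * Real.exp (-(1 / (1 - c ^ 2)) / 2) with hCdef
  have hCpos : 0 < C := by positivity
  have hle : ∀ k : ℕ, C * (k : ℝ)⁻¹ ≤
      (gaussianReal 0 1).real (Set.Ici (c * Real.sqrt (2 * Real.log k))) := by
    intro k
    rcases Nat.eq_zero_or_pos k with rfl | hk
    · simp
    have h := le_gaussianReal_Ici (t := c * Real.sqrt (2 * Real.log k)) (by positivity)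
    refine le_trans ?_ ((ENNReal.ofReal_le_iff_le_toReal (measure_ne_top _ _)).1 h)
    rw [hCdef, mul_assoc]
    gcongr
    have hk' : (0 : ℝ) < k := by exact_mod_cast hk
    rw [← Real.exp_log (inv_pos.2 hk'), ← Real.exp_add, Real.log_inv, Real.exp_le_exp]
    set s := Real.sqrt (2 * Real.log k)
    have hs : s ^ 2 = 2 * Real.log k :=
      Real.sq_sqrt (mul_nonneg zero_le_two (Real.log_natCast_nonneg k))
    have hq : (c * s + 1) ^ 2 ≤ s ^ 2 + 1 / (1 - c ^ 2) := by
      have : s ^ 2 + 1 / (1 - c ^ 2) - (c * s + 1) ^ 2 =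
          ((1 - c ^ 2) * s - c) ^ 2 / (1 - c ^ 2) := by
        field_simp
        ring
      have : 0 ≤ ((1 - c ^ 2) * s - c) ^ 2 / (1 - c ^ 2) := by positivity
      linarith
    linarith
  have hsum := Summable.of_nonneg_of_le (fun k => by positivity) hle
    (ENNReal.summable_toReal htop)
  exact Real.not_summable_natCast_inv ((summable_mul_left_iff hCpos.ne').1 hsum)

theorem limsup_eq_of_forall_eventually_le_of_forall_frequently_ge {u : ℕ → ℝ} {a : ℝ}
    (hle : ∀ n : ℕ, ∀ᶠ k in Filter.atTop, u k ≤ a + 1 / ((n : ℝ) + 2))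
    (hge : ∀ n : ℕ, ∃ᶠ k in Filter.atTop, a - 1 / ((n : ℝ) + 2) ≤ u k) :
    Filter.limsup u Filter.atTop = a := by
  have hbdd : Filter.IsBoundedUnder (· ≤ ·) Filter.atTop u := ⟨_, hle 0⟩
  have hcobdd : Filter.IsCoboundedUnder (· ≤ ·) Filter.atTop u :=
    Filter.IsCoboundedUnder.of_frequently_ge (hge 0)
  have hlim : Filter.Tendsto (fun n : ℕ => 1 / ((n : ℝ) + 2)) Filter.atTop (nhds 0) := by
    simpa using! tendsto_const_nhds (x := (1 : ℝ)).div_atTop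
      (Filter.tendsto_atTop_add_const_right _ (2 : ℝ) tendsto_natCast_atTop_atTop)
  apply le_antisymm
  · refine ge_of_tendsto' (add_zero a ▸ hlim.const_add a) fun n => ?_
    exact Filter.limsup_le_of_le hcobdd (hle n)
  · refine le_of_tendsto' (sub_zero a ▸ hlim.const_sub a) fun n => ?_
    exact Filter.le_limsup_of_frequently_le (hge n) hbdd

/-- For the countable product `μ` of standard Gaussian measures on `ℝ^ℕ` (characterized by
its finite-dimensional marginals), for `μ`-almost every `x` one has
`limsup_{k→∞} |x_k| / √(2 ln k) = 1`. -/
theorem stmt12 (μ : Measure (ℕ → ℝ)) [IsProbabilityMeasure μ]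
    (hμ : ∀ s : Finset ℕ, Measure.map (fun (x : ℕ → ℝ) (i : s) => x i) μ =
      Measure.pi fun _ : s => gaussianReal 0 1) :
    ∀ᵐ x ∂μ, Filter.limsup (fun k : ℕ => |x k| / Real.sqrt (2 * Real.log k))
      Filter.atTop = 1 := by
  obtain rfl : μ = Measure.infinitePi fun _ : ℕ => gaussianReal 0 1 :=
    IsProjectiveLimit.unique hμ
      (Measure.isProjectiveLimit_infinitePi fun _ : ℕ => gaussianReal 0 1)
  set μ := Measure.infinitePi fun _ : ℕ => gaussianReal 0 1
  have heval (k : ℕ) {s : Set ℝ} (hs : MeasurableSet s) :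
      μ {x | x k ∈ s} = gaussianReal 0 1 s :=
    (measurePreserving_eval_infinitePi (fun _ : ℕ => gaussianReal 0 1) k).measure_preimage
      hs.nullMeasurableSet
  have hlog : ∀ᶠ k : ℕ in Filter.atTop, 0 < Real.sqrt (2 * Real.log k) := by
    filter_upwards [Filter.eventually_gt_atTop 1] with k hk
    have := Real.log_pos (x := k) (by exact_mod_cast hk)
    positivity
  have hupper (n : ℕ) : ∀ᵐ x ∂μ, ∀ᶠ k : ℕ in Filter.atTop,
      |x k| / Real.sqrt (2 * Real.log k) ≤ 1 + 1 / ((n : ℝ) + 2) := by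
    have hc : (1 : ℝ) < 1 + 1 / ((n : ℝ) + 2) := lt_add_of_pos_right _ (by positivity)
    have hsum : ∑' k : ℕ, μ {x | x k ∈ {y : ℝ |
        (1 + 1 / ((n : ℝ) + 2)) * Real.sqrt (2 * Real.log k) ≤ |y|}} ≠ ⊤ := by
      simp_rw [fun k : ℕ => heval k (measurableSet_le measurable_const measurable_abs :
        MeasurableSet {y : ℝ | (1 + 1 / ((n : ℝ) + 2)) * Real.sqrt (2 * Real.log k) ≤ |y|})]
      exact tsum_gaussianReal_abs_ge_ne_top hc
    filter_upwards [ae_eventually_notMem hsum] with x hx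
    filter_upwards [hx, hlog] with k hk hpos
    rw [div_le_iff₀ hpos]
    exact (not_le.1 hk).le
  have hlower (n : ℕ) : ∀ᵐ x ∂μ, ∃ᶠ k : ℕ in Filter.atTop,
      1 - 1 / ((n : ℝ) + 2) ≤ |x k| / Real.sqrt (2 * Real.log k) := by
    have hc₁ : 1 - 1 / ((n : ℝ) + 2) < 1 := sub_lt_self _ (by positivity)
    have hc₀ : 0 < 1 - 1 / ((n : ℝ) + 2) := by
      rw [sub_pos, div_lt_one (by positivity)]
      linarith [Nat.cast_nonneg (α := ℝ) n]
    set c := 1 - 1 / ((n : ℝ) + 2)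
    have hmeas (k : ℕ) : MeasurableSet {x : ℕ → ℝ |
        x k ∈ Set.Ici (c * Real.sqrt (2 * Real.log k))} :=
      measurable_pi_apply k measurableSet_Ici
    have hindep : iIndepSet (fun k : ℕ => {x : ℕ → ℝ |
        x k ∈ Set.Ici (c * Real.sqrt (2 * Real.log k))}) μ := by
      rw [iIndepSet_iff_meas_biInter hmeas]
      intro s
      exact (iIndepFun_infinitePi (P := fun _ : ℕ => gaussianReal 0 1)
        (X := fun _ y => y) fun _ => measurable_id).measure_inter_preimage_eq_mul s
          fun _ _ => measurableSet_Ici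
    have hone := measure_limsup_eq_one hmeas hindep (by
      simp_rw [fun k : ℕ => heval k
        (measurableSet_Ici (a := c * Real.sqrt (2 * Real.log k)))]
      exact tsum_gaussianReal_Ici_eq_top hc₀ hc₁)
    have hae := (mem_ae_iff_prob_eq_one (MeasurableSet.measurableSet_limsup hmeas)).2 hone
    filter_upwards [hae] with x hx
    rw [Filter.mem_limsup_iff_frequently_mem] at hx
    refine (hx.and_eventually hlog).mono fun k hk => ?_
    rw [le_div_iff₀ hk.2]
    exact le_trans hk.1 (le_abs_self _)
  filter_upwards [ae_all_iff.2 hupper, ae_all_iff.2 hlower] with x hx₁ hx₂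
  exact limsup_eq_of_forall_eventually_le_of_forall_frequently_ge hx₁ hx₂
end

section
/- Let μ be the countable product, on ℝ^ℕ = (ℕ → ℝ), of standard Gaussian measures N(0,1). Let λ = (λ₀, λ₁, …) be a real sequence with λ_k > −1 for all k and ∑_k λ_k² < ∞. Then the diagonal transformation x ↦ ((1+λ₀)x₀, (1+λ₁)x₁, …) leaves μ quasi-invariant, with Radon–Nikodym density given by the almost-everywhere convergent infinite product ∏_k (1+λ_k)·exp(−½(λ_k² + 2λ_k)x_k²). Precisely: there exists a Borel measurable Φ : ℝ^ℕ → [0,∞) such that for μ-almost every x the partial products ∏_{k<n} (1+λ_k)·exp(−½(λ_k² + 2λ_k)x_k²) converge to Φ(x), and the pushforward of μ under the map x ↦ (x_k/(1+λ_k))_{k∈ℕ} equals the measure with density Φ with respect to μ. -/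
open MeasureTheory ProbabilityTheory

section

open Filter Topology Finset
open scoped ENNReal

section InfiniteProduct

variable {X : ℕ → Type*} [∀ i, MeasurableSpace (X i)]
  {μ ν : ∀ i, Measure (X i)} [∀ i, IsProbabilityMeasure (μ i)]

/-- Tonelli for a finite product of functions of distinct coordinates. -/
lemma lintegral_finsetProd_infinitePi (s : Finset ℕ) {f : ∀ i, X i → ℝ≥0∞}
    (hf : ∀ i, Measurable (f i)) :
    ∫⁻ x, ∏ i ∈ s, f i (x i) ∂Measure.infinitePi μ = ∏ i ∈ s, ∫⁻ x, f i x ∂μ i := by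
  refine (lintegral_prod_eq_prod_lintegral_of_indepFun s (fun i (x : ∀ i, X i) => f i (x i))
    (iIndepFun_infinitePi hf) fun i => by fun_prop).trans ?_
  refine prod_congr rfl fun i _ => ?_
  exact (measurePreserving_eval_infinitePi μ i).lintegral_comp (hf i)

lemma integral_finsetProd_infinitePi (s : Finset ℕ) {f : ∀ i, X i → ℝ}
    (hf : ∀ i, Measurable (f i)) :
    ∫ x, ∏ i ∈ s, f i (x i) ∂Measure.infinitePi μ = ∏ i ∈ s, ∫ x, f i x ∂μ i := by
  have hm : Measurable fun y : (i : s) → X i => ∏ i : s, f i (y i) := by fun_prop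
  calc _ = ∫ x, (fun y : (i : s) → X i => ∏ i : s, f i (y i)) (s.restrict x)
        ∂Measure.infinitePi μ := by
        refine integral_congr_ae (.of_forall fun x => ?_)
        exact (prod_coe_sort s fun i => f i (x i)).symm
    _ = ∫ y, ∏ i : s, f i (y i) ∂Measure.pi fun i : s => μ i :=
        integral_restrict_infinitePi μ hm.aestronglyMeasurable
    _ = _ := by
        rw [integral_fintype_prod_eq_prod (fun i : s => f i),
          prod_coe_sort s fun i => ∫ x, f i x ∂μ i]

lemma integrable_finsetProd_infinitePi (s : Finset ℕ) {f : ∀ i, X i → ℝ}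
    (hf : ∀ i ∈ s, Integrable (f i) (μ i)) :
    Integrable (fun x => ∏ i ∈ s, f i (x i)) (Measure.infinitePi μ) := by
  have h : Integrable (fun y : (i : s) → X i => ∏ i : s, f i (y i))
      (Measure.pi fun i : s => μ i) := Integrable.fintype_prod_dep fun i => hf i i.2
  rw [← Measure.infinitePi_map_restrict μ (I := s)] at h
  have h' := h.comp_measurable (measurable_restrict s)
  refine h'.congr (.of_forall fun x => ?_)
  exact prod_coe_sort s fun i => f i (x i)

/-- On events depending on the coordinates in `s`, the product of the densities over `s` is a
density of `infinitePi ν` with respect to `infinitePi μ`. -/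
lemma withDensity_finsetProd_apply_of_piFinset [∀ i, IsProbabilityMeasure (ν i)]
    {p : ∀ i, X i → ℝ≥0∞} (hp : ∀ i, Measurable (p i))
    (hν : ∀ i, ν i = (μ i).withDensity (p i)) (s : Finset ℕ) {A : Set (∀ i, X i)}
    (hA : MeasurableSet[Filtration.piFinset (X := X) s] A) :
    (Measure.infinitePi μ).withDensity (fun x => ∏ i ∈ s, p i (x i)) A =
      Measure.infinitePi ν A := by
  obtain ⟨B, hB, rfl⟩ := hA
  rw [← Measure.map_apply (measurable_restrict s) hB,
    ← Measure.map_apply (measurable_restrict s) hB, Measure.infinitePi_map_restrict]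
  congr 1
  refine (Measure.pi_eq fun t ht => ?_).symm
  classical
  have ht' (i) : MeasurableSet (if h : i ∈ s then t ⟨i, h⟩ else Set.univ) := by
    split_ifs
    exacts [ht _, .univ]
  rw [Measure.map_apply (measurable_restrict s) (.univ_pi ht), restrict_preimage_univ,
    withDensity_apply _ (.pi s.countable_toSet fun i _ => ht' i), ← lintegral_indicator
    (.pi s.countable_toSet fun i _ => ht' i)]
  calc _ = ∫⁻ x, ∏ i ∈ s, (if h : i ∈ s then t ⟨i, h⟩ else Set.univ).indicator (p i) (x i)
        ∂Measure.infinitePi μ := by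
        refine lintegral_congr fun x => ?_
        by_cases hx : x ∈ Set.pi s fun i => if h : i ∈ s then t ⟨i, h⟩ else Set.univ
        · rw [Set.indicator_of_mem hx]
          exact prod_congr rfl fun i hi => (Set.indicator_of_mem (hx i hi) _).symm
        · rw [Set.indicator_of_notMem hx]
          simp only [Set.mem_pi, not_forall] at hx
          obtain ⟨i, hi, hxi⟩ := hx
          exact (prod_eq_zero hi (Set.indicator_of_notMem hxi _)).symm
    _ = ∏ i ∈ s, ν i (if h : i ∈ s then t ⟨i, h⟩ else Set.univ) := by
        rw [lintegral_finsetProd_infinitePi s fun i => (hp i).indicator (ht' i)]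
        refine prod_congr rfl fun i _ => ?_
        rw [lintegral_indicator (ht' i), hν, withDensity_apply _ (ht' i)]
    _ = _ := by
        rw [← prod_attach, univ_eq_attach]
        exact prod_congr rfl fun i _ => by rw [dif_pos i.2]

end InfiniteProduct

/-- A sequence of nonnegative functions that is Cauchy in `L¹` has a nonnegative measurable limit
in `L¹`. -/
lemma exists_nonneg_tendsto_lintegral_enorm_sub {Ω : Type*} [MeasurableSpace Ω] {P : Measure Ω}
    {f : ℕ → Ω → ℝ} (hf : ∀ n, Integrable (f n) P) (hf0 : ∀ n x, 0 ≤ f n x)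
    (hc : ∀ ε > 0, ∃ N, ∀ n ≥ N, ∫ x, |f n x - f N x| ∂P < ε) :
    ∃ g : Ω → ℝ, Measurable g ∧ (∀ x, 0 ≤ g x) ∧ Integrable g P ∧
      Tendsto (fun n => ∫⁻ x, ‖f n x - g x‖ₑ ∂P) atTop (𝓝 0) := by
  have hcauchy : CauchySeq fun n => (hf n).toL1 (f n) := by
    refine Metric.cauchySeq_iff'.2 fun ε hε => ?_
    obtain ⟨N, hN⟩ := hc ε hε
    refine ⟨N, fun n hn => ?_⟩
    rw [dist_eq_norm, ← Integrable.toL1_sub, L1.norm_of_fun_eq_integral_norm]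
    exact hN n hn
  obtain ⟨G, hG⟩ := cauchySeq_tendsto_of_complete hcauchy
  have hGm : Measurable G := (Lp.stronglyMeasurable G).measurable
  have hGi : Integrable G P := L1.integrable_coeFn G
  refine ⟨fun x => max (G x) 0, hGm.max measurable_const, fun x => le_max_right _ _,
    hGi.pos_part, ?_⟩
  rw [tendsto_iff_edist_tendsto_0] at hG
  refine tendsto_of_tendsto_of_tendsto_of_le_of_le tendsto_const_nhds hG (fun _ => zero_le)
    fun n => ?_
  have h : edist ((hf n).toL1 (f n)) G = ∫⁻ x, edist (f n x) (G x) ∂P := by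
    rw [← Integrable.edist_toL1_toL1 (f n) G (hf n) hGi, Integrable.toL1_coeFn]
  simp only [h]
  refine lintegral_mono fun x => ?_
  rw [edist_eq_enorm_sub, enorm_le_iff_norm_le, Real.norm_eq_abs, Real.norm_eq_abs]
  simpa [max_eq_left (hf0 n x)] using abs_max_sub_max_le_abs (f n x) (G x) 0

section Kakutani

variable {X : ℕ → Type*} [∀ i, MeasurableSpace (X i)]
  {μ ν : ∀ i, Measure (X i)} [∀ i, IsProbabilityMeasure (μ i)] {q : ∀ i, X i → ℝ} {c : ℕ → ℝ}

/-- The filtration on a sequence space whose `n`-th element is generated by the first `n`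
coordinates. -/
def piRangeFiltration (X : ℕ → Type*) [∀ i, MeasurableSpace (X i)] :
    Filtration ℕ (MeasurableSpace.pi (X := X)) where
  seq n := Filtration.piFinset (X := X) (range n)
  mono' _ _ h := Filtration.piFinset.mono (range_mono h)
  le' n := Filtration.piFinset.le (range n)

lemma measurable_eval_piFinset {s : Finset ℕ} {i : ℕ} (hi : i ∈ s) :
    Measurable[Filtration.piFinset (X := X) s] fun x : ∀ i, X i => x i := by
  have h : Measurable[Filtration.piFinset (X := X) s] (s.restrict : (∀ i, X i) → ∀ i : s, X i) :=
    comap_measurable _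
  exact (measurable_pi_apply (⟨i, hi⟩ : s)).comp h

lemma iSup_piRangeFiltration : ⨆ n, piRangeFiltration X n = MeasurableSpace.pi := by
  refine le_antisymm (iSup_le fun n => (piRangeFiltration X).le n) (iSup_le fun i => ?_)
  exact (measurable_eval_piFinset (self_mem_range_succ i)).comap_le.trans
    (le_iSup (fun n => piRangeFiltration X n) (i + 1))

lemma measurable_finsetProd_piFinset (hq : ∀ i, Measurable (q i)) (s : Finset ℕ) :
    Measurable[Filtration.piFinset (X := X) s] fun x => ∏ i ∈ s, q i (x i) :=
  measurable_fun_prod s fun i hi => (hq i).comp (measurable_eval_piFinset hi)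

/-- Partial products of densities whose second moments have a convergent product are Cauchy in
`L¹`. -/
lemma exists_integral_abs_sub_prod_range_lt (hq : ∀ i, Measurable (q i)) (hq0 : ∀ i x, 0 ≤ q i x)
    (hqi : ∀ i, Integrable (q i) (μ i)) (hq1 : ∀ i, ∫ x, q i x ∂μ i = 1) (hc : Summable c)
    (hqc : ∀ᶠ i in atTop, Integrable (fun x => q i x ^ 2) (μ i) ∧
      ∫ x, q i x ^ 2 ∂μ i ≤ Real.exp (c i)) {ε : ℝ} (hε : 0 < ε) :
    ∃ N, ∀ n ≥ N, ∫ x, |(∏ i ∈ range n, q i (x i)) - ∏ i ∈ range N, q i (x i)|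
      ∂Measure.infinitePi μ < ε := by
  have hexp : ∀ᶠ z in 𝓝 (0 : ℝ), Real.exp z < 1 + ε ^ 2 :=
    Real.continuous_exp.tendsto' 0 1 Real.exp_zero |>.eventually_lt_const (by nlinarith)
  obtain ⟨δ, hδ, hexp⟩ := Metric.eventually_nhds_iff.1 hexp
  obtain ⟨N₁, hN₁⟩ := Metric.cauchySeq_iff.1 hc.hasSum.tendsto_sum_nat.cauchySeq δ hδ
  obtain ⟨N₂, hN₂⟩ := eventually_atTop.1 hqc
  refine ⟨max N₁ N₂, fun n hn => ?_⟩
  set N := max N₁ N₂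
  let r (j k : ℕ) (y : X k) : ℝ := if k < N then q k y else q k y ^ j
  have hr (j k : ℕ) : Measurable (r j k) := by
    by_cases hk : k < N
    · simpa only [r, if_pos hk] using hq k
    · simpa only [r, if_neg hk] using (hq k).pow_const j
  have hri (j : ℕ) (hj : j ≤ 2) (k : ℕ) : Integrable (r j k) (μ k) := by
    by_cases hk : k < N
    · simpa only [r, if_pos hk] using hqi k
    · simp only [r, if_neg hk]
      interval_cases j
      · simp
      · simpa using hqi k
      · exact (hN₂ k (by grind)).1
  have hri' (j : ℕ) (hj : j ≤ 2) :
      Integrable (fun x => ∏ k ∈ range n, r j k (x k)) (Measure.infinitePi μ) :=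
    integrable_finsetProd_infinitePi _ fun k _ => hri j hj k
  have hr1 (j : ℕ) : ∫ x, ∏ k ∈ range n, r j k (x k) ∂Measure.infinitePi μ =
      ∏ k ∈ Ico N n, ∫ y, q k y ^ j ∂μ k := by
    rw [integral_finsetProd_infinitePi _ (hr j), ← prod_range_mul_prod_Ico _ hn,
      prod_eq_one, one_mul]
    · exact prod_congr rfl fun k hk => by simp [r, (mem_Ico.1 hk).1.not_gt]
    · exact fun k hk => by simp [r, mem_range.1 hk, hq1]
  have hrP (j : ℕ) (x : ∀ i, X i) : ∏ k ∈ range n, r j k (x k) =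
      (∏ k ∈ range N, q k (x k)) * (∏ k ∈ Ico N n, q k (x k)) ^ j := by
    rw [← prod_range_mul_prod_Ico _ hn, ← prod_pow]
    congr 1
    · exact prod_congr rfl fun k hk => by simp [r, mem_range.1 hk]
    · exact prod_congr rfl fun k hk => by simp [r, (mem_Ico.1 hk).1.not_gt]
  have hsecond : ∏ k ∈ Ico N n, ∫ y, q k y ^ 2 ∂μ k < 1 + ε ^ 2 := by
    refine lt_of_le_of_lt (prod_le_prod (fun k _ => integral_nonneg fun y => sq_nonneg _)
      fun k hk => (hN₂ k (by grind)).2) ?_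
    rw [← Real.exp_sum]
    refine hexp ?_
    rw [sum_Ico_eq_sub _ hn]
    simpa [Real.dist_eq] using hN₁ n (by grind) N (by grind)
  have hpoint (x : ∀ i, X i) :
      |(∏ i ∈ range n, q i (x i)) - ∏ i ∈ range N, q i (x i)| ≤
        (2 * ε)⁻¹ * (∏ k ∈ range n, r 2 k (x k)) - ε⁻¹ * (∏ k ∈ range n, r 1 k (x k))
          + (ε / 2 + (2 * ε)⁻¹) * ∏ k ∈ range n, r 0 k (x k) := by
    rw [← prod_range_mul_prod_Ico _ hn, hrP, hrP, hrP]
    have hA : 0 ≤ ∏ k ∈ range N, q k (x k) := prod_nonneg fun k _ => hq0 _ _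
    generalize ∏ k ∈ range N, q k (x k) = a at *
    generalize ∏ k ∈ Ico N n, q k (x k) = b
    have h1 : |b - 1| ≤ ε / 2 + (2 * ε)⁻¹ * (b - 1) ^ 2 := by
      rw [← sq_abs (b - 1)]
      have : ε / 2 + (2 * ε)⁻¹ * |b - 1| ^ 2 - |b - 1| = (2 * ε)⁻¹ * (|b - 1| - ε) ^ 2 := by
        field_simp
        ring
      have : 0 ≤ (2 * ε)⁻¹ * (|b - 1| - ε) ^ 2 := by positivity
      linarith
    calc |a * b - a| = a * |b - 1| := by rw [← mul_sub_one, abs_mul, abs_of_nonneg hA]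
      _ ≤ a * (ε / 2 + (2 * ε)⁻¹ * (b - 1) ^ 2) := by gcongr
      _ = _ := by
        field_simp
        ring
  have h2 := (hri' 2 le_rfl).const_mul (2 * ε)⁻¹
  have h1 := (hri' 1 one_le_two).const_mul ε⁻¹
  have h0 := (hri' 0 zero_le_two).const_mul (ε / 2 + (2 * ε)⁻¹)
  calc _ ≤ _ := integral_mono_of_nonneg (.of_forall fun x => abs_nonneg _)
        ((h2.sub h1).add h0) (.of_forall hpoint)
    _ = (2 * ε)⁻¹ * (∏ k ∈ Ico N n, ∫ y, q k y ^ 2 ∂μ k) - ε⁻¹ + (ε / 2 + (2 * ε)⁻¹) := by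
        rw [integral_add' (h2.sub h1) h0, integral_sub' h2 h1, integral_const_mul,
          integral_const_mul, integral_const_mul, hr1, hr1, hr1]
        simp [hq1]
    _ < (2 * ε)⁻¹ * (1 + ε ^ 2) - ε⁻¹ + (ε / 2 + (2 * ε)⁻¹) := by gcongr
    _ = ε := by
        field_simp
        ring

/-- A criterion of Kakutani type: if `ν i` has density `q i` with respect to `μ i` and the second
moments of the densities have a convergent product, then the infinite product of the `ν i` has a
density with respect to that of the `μ i`, and the partial products of the densities converge to it
almost everywhere. -/
theorem exists_density_infinitePi [∀ i, IsProbabilityMeasure (ν i)]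
    (hq : ∀ i, Measurable (q i)) (hq0 : ∀ i x, 0 ≤ q i x)
    (hν : ∀ i, ν i = (μ i).withDensity fun x => ENNReal.ofReal (q i x)) (hc : Summable c)
    (hqc : ∀ᶠ i in atTop, Integrable (fun x => q i x ^ 2) (μ i) ∧
      ∫ x, q i x ^ 2 ∂μ i ≤ Real.exp (c i)) :
    ∃ Φ : (∀ i, X i) → ℝ, Measurable Φ ∧ (∀ x, 0 ≤ Φ x) ∧
      (∀ᵐ x ∂Measure.infinitePi μ,
        Tendsto (fun n => ∏ i ∈ range n, q i (x i)) atTop (𝓝 (Φ x))) ∧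
      Measure.infinitePi ν =
        (Measure.infinitePi μ).withDensity fun x => ENNReal.ofReal (Φ x) := by
  have hlq (i) : ∫⁻ x, ENNReal.ofReal (q i x) ∂μ i = 1 := by
    rw [← setLIntegral_univ, ← withDensity_apply _ .univ, ← hν, measure_univ]
  have hqi (i) : Integrable (q i) (μ i) :=
    (lintegral_ofReal_ne_top_iff_integrable (hq i).aestronglyMeasurable
      (.of_forall (hq0 i))).1 (by simp [hlq])
  have hq1 (i) : ∫ x, q i x ∂μ i = 1 := by
    rw [integral_eq_lintegral_of_nonneg_ae (.of_forall (hq0 i)) (hq i).aestronglyMeasurable, hlq,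
      ENNReal.toReal_one]
  have hf (n : ℕ) : Integrable (fun x => ∏ i ∈ range n, q i (x i)) (Measure.infinitePi μ) :=
    integrable_finsetProd_infinitePi _ fun i _ => hqi i
  have hf0 (n : ℕ) (x : ∀ i, X i) : 0 ≤ ∏ i ∈ range n, q i (x i) := prod_nonneg fun i _ => hq0 _ _
  obtain ⟨Φ, hΦ, hΦ0, hΦi, hlim⟩ := exists_nonneg_tendsto_lintegral_enorm_sub hf hf0
    fun ε hε => exists_integral_abs_sub_prod_range_lt hq hq0 hqi hq1 hc hqc hε
  have hpartial (n : ℕ) (A : Set (∀ i, X i)) (hA : MeasurableSet[piRangeFiltration X n] A) :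
      ∫ x in A, ∏ i ∈ range n, q i (x i) ∂Measure.infinitePi μ =
        (Measure.infinitePi ν).real A := by
    rw [measureReal_def, ← withDensity_finsetProd_apply_of_piFinset
      (fun i => (hq i).ennreal_ofReal) hν (range n) hA,
      withDensity_apply _ ((piRangeFiltration X).le n A hA),
      integral_eq_lintegral_of_nonneg_ae (.of_forall (hf0 n)) (hf n).1.restrict]
    simp_rw [ENNReal.ofReal_prod_of_nonneg fun i _ => hq0 i _]
  have hlimit (n : ℕ) (A : Set (∀ i, X i)) (hA : MeasurableSet[piRangeFiltration X n] A) :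
      ∫ x in A, Φ x ∂Measure.infinitePi μ = (Measure.infinitePi ν).real A := by
    refine tendsto_nhds_unique (tendsto_setIntegral_of_L1 Φ hΦi.1 (.of_forall hf) hlim A) ?_
    refine tendsto_const_nhds.congr' ?_
    filter_upwards [eventually_ge_atTop n] with m hm
    exact (hpartial m A ((piRangeFiltration X).mono hm A hA)).symm
  refine ⟨Φ, hΦ, hΦ0, ?_, ?_⟩
  · have hcond (n : ℕ) : (fun x => ∏ i ∈ range n, q i (x i)) =ᵐ[Measure.infinitePi μ]
        (Measure.infinitePi μ)[Φ | piRangeFiltration X n] := by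
      refine ae_eq_condExp_of_forall_setIntegral_eq ((piRangeFiltration X).le n) hΦi
        (fun _ _ _ => (hf n).integrableOn) (fun A hA _ => ?_)
        (measurable_finsetProd_piFinset hq (range n)).stronglyMeasurable.aestronglyMeasurable
      rw [hpartial n A hA, hlimit n A hA]
    have hlevy := hΦi.tendsto_ae_condExp (ℱ := piRangeFiltration X)
      (by rw [iSup_piRangeFiltration]; exact hΦ.stronglyMeasurable)
    filter_upwards [hlevy, ae_all_iff.2 hcond] with x hx hx'
    exact hx.congr fun n => (hx' n).symm
  · refine (Measure.eq_infinitePi ν fun s t ht => ?_).symm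
    have hA : MeasurableSet[piRangeFiltration X (s.sup id + 1)] (Set.pi s t) := by
      rw [Set.pi_def]
      refine Finset.measurableSet_biInter s fun i hi => ?_
      exact measurable_eval_piFinset
        (mem_range.2 (Nat.lt_succ_of_le (le_sup (f := id) hi))) (ht i)
    have hA' := (piRangeFiltration X).le _ _ hA
    rw [withDensity_apply _ hA', ← ofReal_integral_eq_lintegral_ofReal hΦi.integrableOn
      (.of_forall hΦ0), hlimit _ _ hA, ofReal_measureReal, Measure.infinitePi_pi ν fun i _ => ht i]

end Kakutani

section Gaussian

/-- Dividing a standard Gaussian variable by `1 + a` gives a density. -/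
lemma gaussianReal_map_div_eq_withDensity {a : ℝ} (ha : -1 < a) :
    (gaussianReal 0 1).map (fun x => x / (1 + a)) = (gaussianReal 0 1).withDensity fun x =>
      ENNReal.ofReal ((1 + a) * Real.exp (-(a ^ 2 + 2 * a) * x ^ 2 / 2)) := by
  have ha' : 0 < 1 + a := by linarith
  let e : ℝ ≃ᵐ ℝ := (Homeomorph.mulRight₀ (1 + a) ha'.ne').toMeasurableEquiv
  have he : ∀ x, HasDerivAt e ((fun _ => 1 + a) x) x := fun x => by
    have h : HasDerivAt (fun y => y * (1 + a)) (1 + a) x := by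
      simpa using (hasDerivAt_id x).mul_const (1 + a)
    exact h
  have hp : Measurable fun x : ℝ => (1 + a) * Real.exp (-(a ^ 2 + 2 * a) * x ^ 2 / 2) := by
    fun_prop
  have hes : (e.symm : ℝ → ℝ) = fun x => x / (1 + a) := by
    ext x
    exact (div_eq_mul_inv x (1 + a)).symm
  ext s hs
  rw [← hes, MeasurableEquiv.gaussianReal_map_symm_apply one_ne_zero e he hs,
    gaussianReal_of_var_ne_zero _ one_ne_zero,
    ← withDensity_mul _ (measurable_gaussianPDF 0 1) hp.ennreal_ofReal, withDensity_apply _ hs]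
  have hint : Integrable fun x => |1 + a| * gaussianPDFReal 0 1 (e x) :=
    ((integrable_gaussianPDFReal 0 1).comp_mul_right' ha'.ne').const_mul _
  rw [ofReal_integral_eq_lintegral_ofReal hint.integrableOn
    (.of_forall fun x => mul_nonneg (abs_nonneg _) (gaussianPDFReal_nonneg _ _ _))]
  refine lintegral_congr fun x => ?_
  rw [Pi.mul_apply, gaussianPDF, ← ENNReal.ofReal_mul (gaussianPDFReal_nonneg _ _ _)]
  congr 1
  have hex : e x = x * (1 + a) := rfl
  rw [hex, abs_of_pos ha', gaussianPDFReal, gaussianPDFReal, mul_mul_mul_comm, ← Real.exp_add,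
    mul_left_comm, ← mul_assoc]
  congr 2
  simp only [NNReal.coe_one]
  ring

lemma sq_le_exp_mul_sqrt {a : ℝ} (ha : |a| ≤ 1 / 10) :
    (1 + a) ^ 2 ≤ Real.exp (4 * a ^ 2) * √(2 * (1 + a) ^ 2 - 1) := by
  obtain ⟨h1, h2⟩ := abs_le.1 ha
  refine abs_le_of_sq_le_sq' ?_ (by positivity) |>.2
  have hb : 0.62 ≤ 2 * (1 + a) ^ 2 - 1 := by nlinarith
  rw [mul_pow, Real.sq_sqrt (by linarith), ← Real.exp_nat_mul]
  have hexp := Real.add_one_le_exp (((2 : ℕ) : ℝ) * (4 * a ^ 2))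
  refine le_trans ?_ (mul_le_mul_of_nonneg_right hexp (by linarith))
  push_cast
  have h3 : a ^ 2 * (2 + a) ^ 2 ≤ a ^ 2 * (8 * (2 * (1 + a) ^ 2 - 1)) := by
    gcongr
    nlinarith
  nlinarith

/-- The density of `x / (1 + a)` for a standard Gaussian `x` has second moment `1 + O(a ^ 2)`. -/
lemma integrable_sq_density_gaussianReal {a : ℝ} (ha : |a| ≤ 1 / 10) :
    Integrable (fun x => ((1 + a) * Real.exp (-(a ^ 2 + 2 * a) * x ^ 2 / 2)) ^ 2)
        (gaussianReal 0 1) ∧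
      ∫ x, ((1 + a) * Real.exp (-(a ^ 2 + 2 * a) * x ^ 2 / 2)) ^ 2 ∂gaussianReal 0 1 ≤
        Real.exp (4 * a ^ 2) := by
  obtain ⟨h1, h2⟩ := abs_le.1 ha
  have hb : 0 < (1 + a) ^ 2 - 1 / 2 := by nlinarith
  have hpdf (x : ℝ) : gaussianPDFReal 0 1 x *
      ((1 + a) * Real.exp (-(a ^ 2 + 2 * a) * x ^ 2 / 2)) ^ 2 =
      (√(2 * Real.pi))⁻¹ * (1 + a) ^ 2 * Real.exp (-((1 + a) ^ 2 - 1 / 2) * x ^ 2) := by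
    rw [gaussianPDFReal, mul_pow, ← Real.exp_nat_mul, mul_mul_mul_comm, ← Real.exp_add]
    congr 2
    · simp
    · simp only [NNReal.coe_one]
      push_cast
      ring
  constructor
  · rw [gaussianReal_of_var_ne_zero _ one_ne_zero, integrable_withDensity_iff_integrable_smul'
      (measurable_gaussianPDF 0 1) (.of_forall fun x => gaussianPDF_lt_top)]
    simp_rw [toReal_gaussianPDF, smul_eq_mul, hpdf]
    exact (integrable_exp_neg_mul_sq hb).const_mul _
  · simp_rw [integral_gaussianReal_eq_integral_smul one_ne_zero, smul_eq_mul, hpdf]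
    rw [integral_const_mul, integral_gaussian]
    have hs : √(Real.pi / ((1 + a) ^ 2 - 1 / 2)) =
        √(2 * Real.pi) / √(2 * (1 + a) ^ 2 - 1) := by
      rw [← Real.sqrt_div (by positivity)]
      congr 1
      have : 2 * (1 + a) ^ 2 - 1 ≠ 0 := by nlinarith
      field_simp
    have hpi : 0 < √(2 * Real.pi) := by positivity
    have hb' : 0 < √(2 * (1 + a) ^ 2 - 1) := Real.sqrt_pos.2 (by linarith)
    rw [hs]
    calc _ = (1 + a) ^ 2 / √(2 * (1 + a) ^ 2 - 1) := by field_simp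
      _ ≤ _ := (div_le_iff₀ hb').2 (sq_le_exp_mul_sqrt ha)

end Gaussian

end

/-- Quasi-invariance of the countable product `μ` of standard Gaussians on `ℝ^ℕ` under the
diagonal transformation `x ↦ ((1+λ_k) x_k)_k` with `λ_k > −1`, `∑ λ_k² < ∞`: the
Radon–Nikodym density is the a.e. convergent product `∏_k (1+λ_k) e^{−(λ_k²+2λ_k)x_k²/2}`. -/
theorem stmt14 (μ : Measure (ℕ → ℝ)) [IsProbabilityMeasure μ]
    (hμ : ∀ s : Finset ℕ, Measure.map (fun (x : ℕ → ℝ) (i : s) => x i) μ =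
      Measure.pi fun _ : s => gaussianReal 0 1)
    (l : ℕ → ℝ) (hl : ∀ k, -1 < l k) (hsum : Summable fun k => l k ^ 2) :
    ∃ Φ : (ℕ → ℝ) → ℝ, Measurable Φ ∧ (∀ x, 0 ≤ Φ x) ∧
      (∀ᵐ x ∂μ, Filter.Tendsto
        (fun n => ∏ k ∈ Finset.range n,
          (1 + l k) * Real.exp (-(l k ^ 2 + 2 * l k) * x k ^ 2 / 2))
        Filter.atTop (nhds (Φ x))) ∧
      Measure.map (fun x k => x k / (1 + l k)) μ =
        μ.withDensity fun x => ENNReal.ofReal (Φ x) := by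
  obtain rfl : μ = Measure.infinitePi fun _ : ℕ => gaussianReal 0 1 :=
    IsProjectiveLimit.unique hμ (Measure.isProjectiveLimit_infinitePi _)
  rw [Measure.infinitePi_map_pi (f := fun k y => y / (1 + l k)) _ fun k => by fun_prop]
  have (k : ℕ) : IsProbabilityMeasure ((gaussianReal 0 1).map fun y => y / (1 + l k)) :=
    Measure.isProbabilityMeasure_map (by fun_prop)
  refine exists_density_infinitePi
    (q := fun k y => (1 + l k) * Real.exp (-(l k ^ 2 + 2 * l k) * y ^ 2 / 2))
    (fun k => by fun_prop) (fun k y => mul_nonneg (by linarith [hl k]) (Real.exp_pos _).le)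
    (fun k => gaussianReal_map_div_eq_withDensity (hl k)) (hsum.mul_left 4) ?_
  have hsmall := hsum.tendsto_atTop_zero.eventually_le_const
    (show (0 : ℝ) < (1 / 10) ^ 2 by norm_num)
  filter_upwards [hsmall] with k hk
  exact integrable_sq_density_gaussianReal (abs_le_of_sq_le_sq hk (by norm_num))
end

section
/- Let n, m ≥ 1 and let g = [[α,β],[γ,δ]] ∈ U(n+m) be a complex unitary block matrix with α of size n×n, β of size n×m, γ of size m×n, δ of size m×m, such that 1 + δ is invertible. Then: (a) Υ(g) := α − β(1+δ)⁻¹γ is an n×n unitary matrix; (b) for all h₁, h₂ ∈ U(n), setting ĥᵢ = [[hᵢ, 0],[0, 1_m]] ∈ U(n+m), the δ-block of ĥ₁·g·ĥ₂ is again δ (so Υ(ĥ₁ g ĥ₂) is defined) and Υ(ĥ₁·g·ĥ₂) = h₁·Υ(g)·h₂. -/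
open scoped Matrix

open Matrix in
/-- If `g = [[α,β],[γ,δ]]` is unitary and `X` solves `γ + δ X = -X`, then `g` maps `[1; X]` to
`[α + β X; -X]`, so `α + β X` is unitary. -/
theorem add_mul_mem_unitaryGroup_of_fromBlocks_mem {n m R : Type*} [Fintype n] [DecidableEq n]
    [Fintype m] [DecidableEq m] [CommRing R] [StarRing R]
    {α : Matrix n n R} {β : Matrix n m R} {γ : Matrix m n R} {δ : Matrix m m R}
    (hg : fromBlocks α β γ δ ∈ unitaryGroup (n ⊕ m) R)
    {X : Matrix m n R} (hX : γ + δ * X = -X) :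
    α + β * X ∈ unitaryGroup n R := by
  rw [mem_unitaryGroup_iff', star_eq_conjTranspose] at hg ⊢
  rw [fromBlocks_conjTranspose, fromBlocks_multiply, ← fromBlocks_one, fromBlocks_inj] at hg
  obtain ⟨h₁₁, h₁₂, h₂₁, h₂₂⟩ := hg
  have key : (α + β * X)ᴴ * (α + β * X) + (γ + δ * X)ᴴ * (γ + δ * X) =
      (αᴴ * α + γᴴ * γ) + (αᴴ * β + γᴴ * δ) * X + Xᴴ * (βᴴ * α + δᴴ * γ) +
        Xᴴ * (βᴴ * β + δᴴ * δ) * X := by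
    simp only [conjTranspose_add, conjTranspose_mul, Matrix.mul_add, Matrix.add_mul,
      Matrix.mul_assoc]
    abel
  rw [hX, h₁₁, h₁₂, h₂₁, h₂₂] at key
  simpa using key

/-- For a unitary block matrix `g = [[α,β],[γ,δ]] ∈ U(n+m)` with `1 + δ` invertible:
(a) `Υ(g) = α − β(1+δ)⁻¹γ` is unitary;
(b) for `h₁, h₂ ∈ U(n)`, the `δ`-block of `ĥ₁ g ĥ₂` is again `δ` and
`Υ(ĥ₁ g ĥ₂) = h₁ Υ(g) h₂`, where `ĥᵢ = [[hᵢ,0],[0,1]]`. -/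
theorem stmt17 (n m : ℕ) (hn : 1 ≤ n) (hm : 1 ≤ m)
    (α : Matrix (Fin n) (Fin n) ℂ) (β : Matrix (Fin n) (Fin m) ℂ)
    (γ : Matrix (Fin m) (Fin n) ℂ) (δ : Matrix (Fin m) (Fin m) ℂ)
    (hg : Matrix.fromBlocks α β γ δ ∈ Matrix.unitaryGroup (Fin n ⊕ Fin m) ℂ)
    (hδ : IsUnit (1 + δ)) :
    (α - β * (1 + δ)⁻¹ * γ ∈ Matrix.unitaryGroup (Fin n) ℂ) ∧
    (∀ h₁ ∈ Matrix.unitaryGroup (Fin n) ℂ, ∀ h₂ ∈ Matrix.unitaryGroup (Fin n) ℂ,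
      (Matrix.fromBlocks h₁ 0 0 1 * Matrix.fromBlocks α β γ δ *
          Matrix.fromBlocks h₂ 0 0 1).toBlocks₂₂ = δ ∧
      (Matrix.fromBlocks h₁ 0 0 1 * Matrix.fromBlocks α β γ δ *
            Matrix.fromBlocks h₂ 0 0 1).toBlocks₁₁ -
          (Matrix.fromBlocks h₁ 0 0 1 * Matrix.fromBlocks α β γ δ *
            Matrix.fromBlocks h₂ 0 0 1).toBlocks₁₂ *
          (1 + (Matrix.fromBlocks h₁ 0 0 1 * Matrix.fromBlocks α β γ δ *
            Matrix.fromBlocks h₂ 0 0 1).toBlocks₂₂)⁻¹ *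
          (Matrix.fromBlocks h₁ 0 0 1 * Matrix.fromBlocks α β γ δ *
            Matrix.fromBlocks h₂ 0 0 1).toBlocks₂₁ =
        h₁ * (α - β * (1 + δ)⁻¹ * γ) * h₂) := by
  refine ⟨?_, fun h₁ _ h₂ _ => ?_⟩
  · have hX : γ + δ * -((1 + δ)⁻¹ * γ) = -(-((1 + δ)⁻¹ * γ)) := by
      have h : (1 + δ) * ((1 + δ)⁻¹ * γ) = γ :=
        Matrix.mul_nonsing_inv_cancel_left _ _ ((Matrix.isUnit_iff_isUnit_det _).mp hδ)
      rw [Matrix.add_mul, Matrix.one_mul] at h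
      rw [neg_neg, Matrix.mul_neg, ← sub_eq_add_neg, sub_eq_iff_eq_add, h]
    simpa [sub_eq_add_neg, Matrix.mul_assoc] using
      add_mul_mem_unitaryGroup_of_fromBlocks_mem hg hX
  · simp [Matrix.fromBlocks_multiply, Matrix.mul_sub, Matrix.sub_mul, Matrix.mul_assoc]
end

section
/- Let n, m ≥ 1 and let μ_{n+m} and μ_n be the normalized Haar probability measures on the compact groups U(n+m) and U(n) of complex unitary matrices. Then the set of g = [[α,β],[γ,δ]] ∈ U(n+m) (blocks as below) for which 1 + δ is not invertible is μ_{n+m}-null, and for every Borel measurable map F : U(n+m) → U(n) satisfying F(g) = α − β(1+δ)⁻¹γ whenever 1 + δ is invertible, the pushforward of μ_{n+m} under F equals μ_n. -/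
open MeasureTheory
open scoped Matrix

/-- The Borel σ-algebra on a unitary group. -/
noncomputable instance unitaryGroupMeasurableSpace (ι : Type*) [Fintype ι] [DecidableEq ι] :
    MeasurableSpace ↥(Matrix.unitaryGroup ι ℂ) := borel _

instance unitaryGroup_borelSpace (ι : Type*) [Fintype ι] [DecidableEq ι] :
    BorelSpace ↥(Matrix.unitaryGroup ι ℂ) := ⟨rfl⟩

instance unitaryGroup_compactSpace (ι : Type*) [Fintype ι] [DecidableEq ι] :
    CompactSpace ↥(Matrix.unitaryGroup ι ℂ) := by
  refine isCompact_iff_compactSpace.mp ?_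
  have hK : IsCompact (Set.univ.pi fun _ => Set.univ.pi fun _ => Metric.closedBall 0 1 :
      Set (Matrix ι ι ℂ)) :=
    isCompact_univ_pi fun _ => isCompact_univ_pi fun _ => isCompact_closedBall _ _
  refine hK.of_isClosed_subset (isClosed_unitary (R := Matrix ι ι ℂ)) fun u hu i _ j _ => ?_
  simpa using entry_norm_bound_of_unitary hu i j

/-- Left-invariant Borel probability measures on a compact group coincide. -/
theorem eq_of_map_mul_left_eq_self {G : Type*} [Group G] [TopologicalSpace G]
    [IsTopologicalGroup G] [CompactSpace G] [MeasurableSpace G] [BorelSpace G]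
    (μ ν : Measure G) [IsProbabilityMeasure μ] [IsProbabilityMeasure ν]
    (hμ : ∀ u : G, μ.map (u * ·) = μ) (hν : ∀ u : G, ν.map (u * ·) = ν) : μ = ν := by
  have haar : ∀ (ρ : Measure G) [IsProbabilityMeasure ρ], (∀ u : G, ρ.map (u * ·) = ρ) →
      ρ.IsHaarMeasure := by
    intro ρ _ hρ
    have : ρ.IsMulLeftInvariant := ⟨hρ⟩
    exact Measure.isHaarMeasure_of_isCompact_nonempty_interior ρ Set.univ isCompact_univ
      (by simp) (by simp) (by simp)
  have := haar μ hμ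
  have := haar ν hν
  exact Measure.isHaarMeasure_eq_of_isProbabilityMeasure μ ν

/-- The block-diagonal embedding `U(ι) × U(κ) → U(ι ⊕ κ)`. -/
def unitaryBlockDiagonal {ι κ : Type*} [Fintype ι] [DecidableEq ι] [Fintype κ] [DecidableEq κ]
    (u : Matrix.unitaryGroup ι ℂ) (v : Matrix.unitaryGroup κ ℂ) :
    Matrix.unitaryGroup (ι ⊕ κ) ℂ :=
  ⟨Matrix.fromBlocks u 0 0 v, by
    rw [Matrix.mem_unitaryGroup_iff, Matrix.star_eq_conjTranspose, Matrix.fromBlocks_conjTranspose,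
      Matrix.fromBlocks_multiply]
    have hu := Matrix.mem_unitaryGroup_iff.mp u.2
    have hv := Matrix.mem_unitaryGroup_iff.mp v.2
    rw [Matrix.star_eq_conjTranspose] at hu hv
    simp [hu, hv]⟩

/-- Left multiplication by a block-diagonal unitary acts on the block rows. -/
theorem coe_unitaryBlockDiagonal_mul {ι κ : Type*} [Fintype ι] [DecidableEq ι] [Fintype κ]
    [DecidableEq κ] (u : Matrix.unitaryGroup ι ℂ) (v : Matrix.unitaryGroup κ ℂ)
    (g : Matrix.unitaryGroup (ι ⊕ κ) ℂ) :
    ((unitaryBlockDiagonal u v * g : Matrix.unitaryGroup (ι ⊕ κ) ℂ) :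
        Matrix (ι ⊕ κ) (ι ⊕ κ) ℂ) =
      Matrix.fromBlocks
        ((u : Matrix ι ι ℂ) * (g : Matrix (ι ⊕ κ) (ι ⊕ κ) ℂ).toBlocks₁₁)
        ((u : Matrix ι ι ℂ) * (g : Matrix (ι ⊕ κ) (ι ⊕ κ) ℂ).toBlocks₁₂)
        ((v : Matrix κ κ ℂ) * (g : Matrix (ι ⊕ κ) (ι ⊕ κ) ℂ).toBlocks₂₁)
        ((v : Matrix κ κ ℂ) * (g : Matrix (ι ⊕ κ) (ι ⊕ κ) ℂ).toBlocks₂₂) := by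
  change Matrix.fromBlocks _ _ _ _ * (g : Matrix (ι ⊕ κ) (ι ⊕ κ) ℂ) = _
  conv_lhs => rw [← Matrix.fromBlocks_toBlocks (g : Matrix (ι ⊕ κ) (ι ⊕ κ) ℂ)]
  rw [Matrix.fromBlocks_multiply]
  simp

/-- A unit complex number as a scalar unitary matrix. -/
noncomputable def unitaryScalar (κ : Type*) [Fintype κ] [DecidableEq κ] (z : Circle) :
    Matrix.unitaryGroup κ ℂ :=
  ⟨(z : ℂ) • 1, by
    rw [Matrix.mem_unitaryGroup_iff]
    simp [smul_smul, ← Circle.coe_inv_eq_conj]⟩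

/-- For `w ≠ 0`, the matrix `1 - w⁻¹d` is singular exactly when `w` is an eigenvalue of `d`. -/
theorem not_isUnit_one_add_smul_iff {κ : Type*} [Fintype κ] [DecidableEq κ]
    (d : Matrix κ κ ℂ) {w : ℂ} (hw : w ≠ 0) :
    ¬ IsUnit (1 + (-w⁻¹) • d) ↔ d.charpoly.IsRoot w := by
  have h : 1 + (-w⁻¹) • d = w⁻¹ • (Matrix.scalar κ w - d) := by
    rw [smul_sub, Matrix.scalar_apply, ← Matrix.smul_one_eq_diagonal, smul_smul,
      inv_mul_cancel₀ hw, one_smul, neg_smul, sub_eq_add_neg]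
  rw [h, Matrix.isUnit_iff_isUnit_det, Matrix.det_smul, isUnit_iff_ne_zero, not_not,
    Polynomial.IsRoot, Matrix.eval_charpoly]
  simp [hw]

/-- The unit circle has infinitely many points. -/
theorem infinite_circle : Infinite Circle := by
  refine Set.infinite_univ_iff.mp (Set.infinite_of_injOn_mapsTo
    (Circle.exp_injOn_Ioc (a := 0) (b := 1) ?_) (Set.mapsTo_univ _ _)
    (Set.Ioc_infinite one_pos))
  linarith [Real.pi_gt_three]

/-- Almost every unitary matrix has a lower right block without the eigenvalue `-1`. -/
theorem measure_not_isUnit_one_add_toBlocks₂₂ {ι κ : Type*} [Fintype ι] [DecidableEq ι]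
    [Fintype κ] [DecidableEq κ] (μ : Measure (Matrix.unitaryGroup (ι ⊕ κ) ℂ))
    [IsProbabilityMeasure μ] (hμ : ∀ u, Measure.map (fun x => u * x) μ = μ) :
    μ {g : Matrix.unitaryGroup (ι ⊕ κ) ℂ | ¬ IsUnit (1 + (g : Matrix (ι ⊕ κ) (ι ⊕ κ) ℂ).toBlocks₂₂)} = 0 := by
  classical
  set S : Set (Matrix.unitaryGroup (ι ⊕ κ) ℂ) :=
    {g | ¬ IsUnit (1 + (g : Matrix (ι ⊕ κ) (ι ⊕ κ) ℂ).toBlocks₂₂)} with hS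
  have hSc : IsClosed S := by
    have : S = {g : Matrix.unitaryGroup (ι ⊕ κ) ℂ |
        (1 + (g : Matrix (ι ⊕ κ) (ι ⊕ κ) ℂ).toBlocks₂₂).det = 0} := by
      ext g
      simp [hS, Matrix.isUnit_iff_isUnit_det]
    rw [this]
    refine isClosed_eq (Continuous.matrix_det (continuous_const.add ?_)) continuous_const
    exact continuous_pi fun i => continuous_pi fun j =>
      continuous_subtype_val.matrix_elem _ _
  let R : Circle → Set (Matrix.unitaryGroup (ι ⊕ κ) ℂ) := fun w =>
    (fun g => unitaryBlockDiagonal 1 (unitaryScalar κ (-w⁻¹)) * g) ⁻¹' S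
  have hRmeas : ∀ w, MeasurableSet (R w) := fun w =>
    (measurable_const_mul _) hSc.measurableSet
  have hR : ∀ w, μ (R w) = μ S := fun w => by
    rw [← Measure.map_apply (measurable_const_mul _) hSc.measurableSet, hμ]
  have hRroot : ∀ w g, g ∈ R w ↔
      (g : Matrix (ι ⊕ κ) (ι ⊕ κ) ℂ).toBlocks₂₂.charpoly.IsRoot (w : ℂ) := fun w g => by
    rw [← not_isUnit_one_add_smul_iff _ w.coe_ne_zero]
    simp only [R, hS, Set.mem_preimage, Set.mem_ofPred_eq, coe_unitaryBlockDiagonal_mul,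
      Matrix.toBlocks_fromBlocks₂₂]
    simp [unitaryScalar]
  have hbound : ∀ (T : Finset Circle) g,
      ∑ w ∈ T, (R w).indicator (fun _ => (1 : ENNReal)) g ≤ Fintype.card κ := fun T g => by
    set p := (g : Matrix (ι ⊕ κ) (ι ⊕ κ) ℂ).toBlocks₂₂.charpoly with hp
    have hp0 : p ≠ 0 := (Matrix.charpoly_monic _).ne_zero
    have hcard : (T.filter (g ∈ R ·)).card ≤ Fintype.card κ := by
      calc (T.filter (g ∈ R ·)).card
          = ((T.filter (g ∈ R ·)).image ((↑) : Circle → ℂ)).card :=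
            (Finset.card_image_of_injective _ Circle.coe_injective).symm
        _ ≤ p.roots.toFinset.card := Finset.card_le_card fun z hz => by
            obtain ⟨w, hw, rfl⟩ := Finset.mem_image.mp hz
            simpa [hp0] using (hRroot w g).mp (Finset.mem_filter.mp hw).2
        _ ≤ p.roots.card := Multiset.toFinset_card_le _
        _ ≤ p.natDegree := p.card_roots'
        _ = Fintype.card κ := Matrix.charpoly_natDegree_eq_dim _
    simp only [Set.indicator_apply, Finset.sum_boole]
    exact_mod_cast hcard
  have hmul : ∀ N : ℕ, N * μ S ≤ Fintype.card κ := fun N => by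
    have := infinite_circle
    obtain ⟨T, hT⟩ := Infinite.exists_subset_card_eq Circle N
    calc N * μ S = ∑ w ∈ T, μ (R w) := by simp [hR, hT]
      _ = ∫⁻ g, ∑ w ∈ T, (R w).indicator (fun _ => (1 : ENNReal)) g ∂μ := by
          rw [lintegral_finsetSum _ fun w _ => measurable_const.indicator (hRmeas w)]
          simp [hRmeas]
      _ ≤ ∫⁻ _, Fintype.card κ ∂μ := lintegral_mono fun g => hbound T g
      _ = Fintype.card κ := by simp
  by_contra h0
  obtain ⟨N, hN⟩ := ENNReal.exists_nat_mul_gt h0 (ENNReal.natCast_ne_top (Fintype.card κ))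
  exact absurd (hmul N) (not_le.mpr hN)

/-- Let `μ` and `ν` be the normalized Haar probability measures on `U(n+m)` and `U(n)`.
The set of `g = [[α,β],[γ,δ]] ∈ U(n+m)` with `1 + δ` not invertible is `μ`-null, and any
Borel measurable `F : U(n+m) → U(n)` with `F(g) = α − β(1+δ)⁻¹γ` whenever `1 + δ` is
invertible pushes `μ` forward to `ν`. -/
theorem stmt18 (n m : ℕ) (hn : 1 ≤ n) (hm : 1 ≤ m)
    (μ : Measure ↥(Matrix.unitaryGroup (Fin n ⊕ Fin m) ℂ)) [IsProbabilityMeasure μ]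
    (hμ : ∀ u, Measure.map (fun x => u * x) μ = μ)
    (ν : Measure ↥(Matrix.unitaryGroup (Fin n) ℂ)) [IsProbabilityMeasure ν]
    (hν : ∀ u, Measure.map (fun x => u * x) ν = ν) :
    μ {g : ↥(Matrix.unitaryGroup (Fin n ⊕ Fin m) ℂ) |
        ¬ IsUnit (1 + ((g : Matrix (Fin n ⊕ Fin m) (Fin n ⊕ Fin m) ℂ)).toBlocks₂₂)} = 0 ∧
    ∀ F : ↥(Matrix.unitaryGroup (Fin n ⊕ Fin m) ℂ) → ↥(Matrix.unitaryGroup (Fin n) ℂ),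
      Measurable F →
      (∀ g : ↥(Matrix.unitaryGroup (Fin n ⊕ Fin m) ℂ),
        IsUnit (1 + ((g : Matrix (Fin n ⊕ Fin m) (Fin n ⊕ Fin m) ℂ)).toBlocks₂₂) →
        (F g : Matrix (Fin n) (Fin n) ℂ) =
          ((g : Matrix (Fin n ⊕ Fin m) (Fin n ⊕ Fin m) ℂ)).toBlocks₁₁ -
            ((g : Matrix (Fin n ⊕ Fin m) (Fin n ⊕ Fin m) ℂ)).toBlocks₁₂ *
              (1 + ((g : Matrix (Fin n ⊕ Fin m) (Fin n ⊕ Fin m) ℂ)).toBlocks₂₂)⁻¹ *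
              ((g : Matrix (Fin n ⊕ Fin m) (Fin n ⊕ Fin m) ℂ)).toBlocks₂₁) →
      Measure.map F μ = ν := by
  have hnull := measure_not_isUnit_one_add_toBlocks₂₂ μ hμ
  refine ⟨hnull, fun F hF hFg => ?_⟩
  have : IsProbabilityMeasure (μ.map F) := Measure.isProbabilityMeasure_map hF.aemeasurable
  refine eq_of_map_mul_left_eq_self _ _ (fun u => ?_) hν
  have hae : (fun g => u * F g) =ᵐ[μ] fun g => F (unitaryBlockDiagonal u 1 * g) := by
    have hunit : ∀ᵐ g : Matrix.unitaryGroup (Fin n ⊕ Fin m) ℂ ∂μ,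
        IsUnit (1 + (g : Matrix (Fin n ⊕ Fin m) (Fin n ⊕ Fin m) ℂ).toBlocks₂₂) := hnull
    filter_upwards [hunit] with g hg
    refine Subtype.ext ?_
    have hblocks := coe_unitaryBlockDiagonal_mul u 1 g
    have hg' : IsUnit (1 + ((unitaryBlockDiagonal u 1 * g :
        Matrix.unitaryGroup (Fin n ⊕ Fin m) ℂ) :
          Matrix (Fin n ⊕ Fin m) (Fin n ⊕ Fin m) ℂ).toBlocks₂₂) := by
      rw [hblocks]
      simpa using hg
    rw [hFg _ hg', hblocks, Submonoid.coe_mul, hFg g hg]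
    simp [mul_sub, Matrix.mul_assoc]
  calc (μ.map F).map (u * ·) = μ.map (fun g => u * F g) :=
        Measure.map_map (measurable_const_mul u) hF
    _ = μ.map (fun g => F (unitaryBlockDiagonal u 1 * g)) := Measure.map_congr hae
    _ = (μ.map (unitaryBlockDiagonal u 1 * ·)).map F :=
        (Measure.map_map hF (measurable_const_mul _)).symm
    _ = μ.map F := by rw [hμ]
end

section
/- Let p, q ≥ 1 and let g = [[α,β],[γ,δ]] be a complex (p+q)×(p+q) block matrix (α of size p×p, δ of size q×q) such that both 1 + g and 1 + δ are invertible. Set Υ(g) := α − β(1+δ)⁻¹γ. Then 1 + Υ(g) is invertible, and the upper-left p×p block of the Cayley transform (1+g)⁻¹(1−g) equals the Cayley transform of Υ(g): [ (1+g)⁻¹(1−g) ]_{p} = (1+Υ(g))⁻¹(1−Υ(g)). -/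
open scoped Matrix

namespace Matrix

variable {m n R : Type*} [Fintype m] [Fintype n] [DecidableEq m] [DecidableEq n] [CommRing R]

theorem inv_one_add_mul_one_sub {X : Matrix n n R} (hX : IsUnit (1 + X)) :
    (1 + X)⁻¹ * (1 - X) = (1 + X)⁻¹ + (1 + X)⁻¹ - 1 := by
  have h : 1 - X = 1 + 1 - (1 + X) := by abel
  rw [h, mul_sub, mul_add, mul_one, nonsing_inv_mul _ ((isUnit_iff_isUnit_det _).mp hX)]

theorem isUnit_schur_complement₂₂ {A : Matrix m m R} {B : Matrix m n R} {C : Matrix n m R}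
    {D : Matrix n n R} (hM : IsUnit (fromBlocks A B C D)) (hD : IsUnit D) :
    IsUnit (A - B * D⁻¹ * C) := by
  let := hD.invertible
  rw [← invOf_eq_nonsing_inv]
  exact isUnit_fromBlocks_iff_of_invertible₂₂.mp hM

theorem toBlocks₁₁_inv_fromBlocks {A : Matrix m m R} {B : Matrix m n R} {C : Matrix n m R}
    {D : Matrix n n R} (hM : IsUnit (fromBlocks A B C D)) (hD : IsUnit D) :
    (fromBlocks A B C D)⁻¹.toBlocks₁₁ = (A - B * D⁻¹ * C)⁻¹ := by
  have hS := isUnit_schur_complement₂₂ hM hD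
  let := hD.invertible
  let := hM.invertible
  rw [← invOf_eq_nonsing_inv D] at hS ⊢
  let := hS.invertible
  rw [← invOf_eq_nonsing_inv, invOf_fromBlocks₂₂_eq, toBlocks_fromBlocks₁₁,
    invOf_eq_nonsing_inv (A - _)]

end Matrix

/-- If `1 + g` and `1 + δ` are invertible, where `g = [[α,β],[γ,δ]]`, then
`1 + Υ(g)` is invertible for `Υ(g) = α − β(1+δ)⁻¹γ`, and the upper-left `p × p`
block of the Cayley transform `(1+g)⁻¹(1−g)` equals the Cayley transform of `Υ(g)`. -/
theorem stmt19 (p q : ℕ) (hp : 1 ≤ p) (hq : 1 ≤ q)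
    (α : Matrix (Fin p) (Fin p) ℂ) (β : Matrix (Fin p) (Fin q) ℂ)
    (γ : Matrix (Fin q) (Fin p) ℂ) (δ : Matrix (Fin q) (Fin q) ℂ)
    (hg : IsUnit (1 + Matrix.fromBlocks α β γ δ)) (hδ : IsUnit (1 + δ)) :
    IsUnit (1 + (α - β * (1 + δ)⁻¹ * γ)) ∧
    ((1 + Matrix.fromBlocks α β γ δ)⁻¹ * (1 - Matrix.fromBlocks α β γ δ)).toBlocks₁₁ =
      (1 + (α - β * (1 + δ)⁻¹ * γ))⁻¹ * (1 - (α - β * (1 + δ)⁻¹ * γ)) := by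
  have hM : 1 + Matrix.fromBlocks α β γ δ = Matrix.fromBlocks (1 + α) β γ (1 + δ) := by
    rw [← Matrix.fromBlocks_one, Matrix.fromBlocks_add, zero_add, zero_add]
  have hS : 1 + (α - β * (1 + δ)⁻¹ * γ) = 1 + α - β * (1 + δ)⁻¹ * γ := (add_sub_assoc ..).symm
  have hU : IsUnit (1 + (α - β * (1 + δ)⁻¹ * γ)) :=
    hS ▸ Matrix.isUnit_schur_complement₂₂ (hM ▸ hg) hδ
  refine ⟨hU, ?_⟩
  have hinv : (1 + Matrix.fromBlocks α β γ δ)⁻¹.toBlocks₁₁ =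
      (1 + (α - β * (1 + δ)⁻¹ * γ))⁻¹ := by
    rw [hS, hM, Matrix.toBlocks₁₁_inv_fromBlocks (hM ▸ hg) hδ]
  rw [Matrix.inv_one_add_mul_one_sub hg, Matrix.inv_one_add_mul_one_sub hU, ← hinv]
  ext i j
  simp [Matrix.toBlocks₁₁, Matrix.one_apply]
end
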